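/- arXiv:1310.5109 — 8 statements merged into one kernel-verified Lean document; each statement's English description precedes it below -/
import Mathlib

section
/- Let Γ be a nilpotent group generated by finitely many elements γ₁, …, γ_r (i.e. there is a map c : Fin r → Γ whose image generates Γ), let n ≥ 1, and let ρ : Γ → GL_n(ℂ) be a group homomorphism. Then the following are equivalent: (1) for every g ∈ GL_n(ℂ), ∑_{i=1}^r ‖g·ρ(γᵢ)·g⁻¹‖² ≥ ∑_{i=1}^r ‖ρ(γᵢ)‖², where ‖·‖ is the Frobenius norm; (2) ρ(γ) is a normal matrix for every γ ∈ Γ. -/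
open Matrix

/-- The squared Frobenius norm `‖m‖² = ∑ i j, |m i j|²` of a complex matrix. -/
noncomputable def sqFrobNorm {n : ℕ} (m : Matrix (Fin n) (Fin n) ℂ) : ℝ :=
  ∑ i, ∑ j, ‖m i j‖ ^ 2

/-- A nilpotent group whose center has finite exponent is a torsion group. -/
theorem Group.IsNilpotent.exists_pow_eq_one_of_center {k : ℕ} (hk : 0 < k) (Q : Type*) [Group Q]
    [Group.IsNilpotent Q] (h : ∀ z ∈ Subgroup.center Q, z ^ k = 1) (x : Q) :
    ∃ N, 0 < N ∧ x ^ N = 1 := by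
  revert h x
  refine Group.nilpotent_center_quotient_ind (P := fun Q _ _ =>
    (∀ z ∈ Subgroup.center Q, z ^ k = 1) → ∀ x : Q, ∃ N, 0 < N ∧ x ^ N = 1) Q ?_ ?_
  · exact fun Q _ _ _ _ => ⟨1, one_pos, Subsingleton.elim _ _⟩
  · intro Q _ _ ih h x
    obtain ⟨N, hN, hxN⟩ := ih (fun z hz => by
      induction z using QuotientGroup.induction_on with
      | H y =>
        rw [← QuotientGroup.mk_pow, QuotientGroup.eq_one_iff, Subgroup.mem_center_iff]
        intro g
        have hy := Subgroup.mem_center_iff.1 hz (g : Q ⧸ Subgroup.center Q)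
        rw [← QuotientGroup.mk_mul, ← QuotientGroup.mk_mul, QuotientGroup.eq] at hy
        have hc := h _ hy
        set z := (g * y)⁻¹ * (y * g) with hz'
        have hyg : y * g = g * (y * z) := by rw [hz']; group
        have hzy : Commute y z := (Subgroup.mem_center_iff.1 hy y)
        have hconj : SemiconjBy g (y * z) y := by
          rw [SemiconjBy, hyg]
        have := hconj.pow_right k
        rw [hzy.mul_pow, hc, mul_one] at this
        exact this) (QuotientGroup.mk x)
    rw [← QuotientGroup.mk_pow, QuotientGroup.eq_one_iff] at hxN
    exact ⟨N * k, Nat.mul_pos hN hk, by rw [pow_mul]; exact h _ hxN⟩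

/-- A nilpotent group acting linearly on a finite-dimensional space, each of its elements with
finite order, fixes a point of every nonempty invariant additively closed set. -/
theorem exists_fixed_of_isNilpotent {Γ K F : Type*} [Group Γ] [Group.IsNilpotent Γ] [Field K]
    [AddCommGroup F] [Module K F] [FiniteDimensional K F] (τ : Γ →* Module.End K F)
    (hfin : ∀ γ, ∃ N, 0 < N ∧ τ γ ^ N = 1) (C : Set F) (hne : C.Nonempty)
    (hadd : ∀ x ∈ C, ∀ y ∈ C, x + y ∈ C) (hinv : ∀ γ, ∀ x ∈ C, τ γ x ∈ C) :
    ∃ x ∈ C, ∀ γ, τ γ x = x := by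
  suffices H : ∀ S : Submodule K F, (∀ γ, ∀ x ∈ S, τ γ x ∈ S) → (∃ x ∈ C, x ∈ S) →
      ∃ x ∈ C, ∀ γ, τ γ x = x by
    obtain ⟨x, hx⟩ := hne
    exact H ⊤ (fun _ _ _ => trivial) ⟨x, hx, trivial⟩
  intro S
  induction S using WellFoundedLT.induction with
  | ind S ih =>
  rintro hS ⟨c, hcC, hcS⟩
  let N : Subgroup Γ :=
    { carrier := {γ | ∀ x ∈ S, τ γ x = x}
      one_mem' := fun x _ => by simp
      mul_mem' := fun {a b} ha hb x hx => by
        rw [map_mul, Module.End.mul_apply, hb x hx, ha x hx]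
      inv_mem' := fun {a} ha x hx => by
        conv_lhs => rw [← ha x hx]
        rw [← Module.End.mul_apply, ← map_mul]; simp }
  have hNn : N.Normal := ⟨fun a ha g x hx => by
    rw [map_mul, map_mul, Module.End.mul_apply, Module.End.mul_apply, ha _ (hS _ _ hx),
      ← Module.End.mul_apply, ← map_mul]; simp⟩
  by_cases htop : N = ⊤
  · exact ⟨c, hcC, fun γ => (htop ▸ Subgroup.mem_top γ : γ ∈ N) c hcS⟩
  have : Nontrivial (Γ ⧸ N) := QuotientGroup.nontrivial_iff.2 htop
  obtain ⟨⟨z, hz⟩, hz1⟩ := Subgroup.ne_bot_iff_exists_ne_one.1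
    (Group.IsNilpotent.center_ne_bot (Γ ⧸ N))
  replace hz1 : z ≠ 1 := fun h => hz1 (Subtype.ext h)
  obtain ⟨x, rfl⟩ := QuotientGroup.mk_surjective z
  have hxN : x ∉ N := fun h => hz1 ((QuotientGroup.eq_one_iff x).2 h)
  have hcomm : ∀ g, ∀ y ∈ S, τ x (τ g y) = τ g (τ x y) := fun g y hy => by
    have h1 := Subgroup.mem_center_iff.1 hz (g : Γ ⧸ N)
    rw [← QuotientGroup.mk_mul, ← QuotientGroup.mk_mul, QuotientGroup.eq] at h1
    have h2 := h1 y hy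
    have h3 : x * g = (g * x) * ((g * x)⁻¹ * (x * g)) := by group
    rw [← Module.End.mul_apply, ← map_mul, h3, map_mul, Module.End.mul_apply, h2, map_mul,
      Module.End.mul_apply]
  let S' : Submodule K F := S ⊓ LinearMap.eqLocus (τ x) 1
  have hS'mem : ∀ y, y ∈ S' ↔ y ∈ S ∧ τ x y = y := fun y => by
    simp [S', LinearMap.mem_eqLocus]
  refine ih S' (lt_of_le_of_ne inf_le_left fun h => hxN fun y hy => ?_) ?_ ?_
  · exact ((hS'mem y).1 (h ▸ hy)).2
  · intro g y hy
    rw [hS'mem] at hy ⊢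
    exact ⟨hS _ _ hy.1, by rw [hcomm g y hy.1, hy.2]⟩
  · obtain ⟨n, hn, hxn⟩ := hfin x
    have hpow : ∀ i, (τ x ^ i) c ∈ C ∧ (τ x ^ i) c ∈ S := fun i => by
      rw [← map_pow]; exact ⟨hinv _ _ hcC, hS _ _ hcS⟩
    refine ⟨∑ i ∈ Finset.range n, (τ x ^ i) c, ?_, (hS'mem _).2 ⟨?_, ?_⟩⟩
    · exact Finset.sum_induction_nonempty _ (· ∈ C) (fun a b ha hb => hadd a ha b hb)
        (Finset.nonempty_range_iff.2 hn.ne') fun i _ => (hpow i).1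
    · exact S.sum_mem fun i _ => (hpow i).2
    · rw [map_sum]
      have h1 := Finset.sum_range_succ (fun i => (τ x ^ i) c) n
      rw [Finset.sum_range_succ', hxn, pow_zero] at h1
      simpa [pow_succ'] using h1

section Forms

open scoped InnerProductSpace

variable {Γ V : Type*} [Group Γ] [NormedAddCommGroup V] [InnerProductSpace ℂ V]

/-- Some inner product `⟪h ·, ·⟫` makes every `ρ γ` normal. The last condition says that the
product of `ρ γ` with its adjoint for this inner product commutes with `ρ γ`. -/
def ExistsNormalizingForm (ρ : Γ →* Module.End ℂ V) : Prop :=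
  ∃ h : Module.End ℂ V, h.IsSymmetric ∧ (∀ v, v ≠ 0 → 0 < (⟪h v, v⟫_ℂ).re) ∧
    ∀ γ, ∃ A : Module.End ℂ V, Commute A (ρ γ) ∧ ∀ v w, ⟪h (ρ γ v), ρ γ w⟫_ℂ = ⟪h v, A w⟫_ℂ

/-- Schur's lemma. -/
theorem exists_eq_smul_one_of_commute [FiniteDimensional ℂ V] [Nontrivial V]
    {ρ : Γ →* Module.End ℂ V}
    (hirr : ∀ W : Submodule ℂ V, (∀ γ, ∀ w ∈ W, ρ γ w ∈ W) → W = ⊥ ∨ W = ⊤)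
    {T : Module.End ℂ V} (hT : ∀ γ, Commute T (ρ γ)) : ∃ μ : ℂ, T = μ • 1 := by
  obtain ⟨μ, hμ⟩ := Module.End.exists_eigenvalue T
  refine ⟨μ, LinearMap.ext fun v => ?_⟩
  have hinv : ∀ γ, ∀ w ∈ T.eigenspace μ, ρ γ w ∈ T.eigenspace μ := fun γ w hw => by
    rw [Module.End.mem_eigenspace_iff] at hw ⊢
    rw [← Module.End.mul_apply, (hT γ).eq, Module.End.mul_apply, hw, map_smul]
  have hv : v ∈ T.eigenspace μ := by
    rw [(hirr _ hinv).resolve_left hμ]; trivial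
  simpa [Module.End.mem_eigenspace_iff] using hv

/-- In an irreducible representation of a nilpotent group, each element has a power acting by a
scalar. -/
theorem exists_pow_eq_smul_one [Group.IsNilpotent Γ] [FiniteDimensional ℂ V] [Nontrivial V]
    {ρ : Γ →* Module.End ℂ V}
    (hirr : ∀ W : Submodule ℂ V, (∀ γ, ∀ w ∈ W, ρ γ w ∈ W) → W = ⊥ ∨ W = ⊤) (x : Γ) :
    ∃ N, 0 < N ∧ ∃ μ : ℂ, ρ x ^ N = μ • 1 := by
  have hinv : ∀ γ, ρ γ * ρ γ⁻¹ = 1 := fun γ => by rw [← map_mul]; simp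
  have hdet : ∀ γ, LinearMap.det (ρ γ) ≠ 0 := fun γ h => by
    have := congrArg LinearMap.det (hinv γ)
    simp [h] at this
  let K : Subgroup Γ :=
    { carrier := {γ | ∀ g, Commute (ρ γ) (ρ g)}
      one_mem' := fun g => by simp
      mul_mem' := fun {a b} ha hb g => by rw [map_mul]; exact (ha g).mul_left (hb g)
      inv_mem' := fun {a} ha g => by
        have := (ha g).eq
        have h1 : ρ a⁻¹ * ρ a = 1 := by rw [← map_mul]; simp
        calc ρ a⁻¹ * ρ g = ρ a⁻¹ * (ρ g * ρ a) * ρ a⁻¹ := by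
              rw [mul_assoc, mul_assoc, hinv, mul_one]
          _ = ρ g * ρ a⁻¹ := by rw [← this, ← mul_assoc, h1, one_mul] }
  have hK : K.Normal := ⟨fun a ha g g' => by
    have : ρ (g * a * g⁻¹) = ρ a := by
      rw [map_mul, map_mul, ← (ha g).eq, mul_assoc, hinv, mul_one]
    rw [this]; exact ha g'⟩
  have hcenter : ∀ z ∈ Subgroup.center (Γ ⧸ K), z ^ Module.finrank ℂ V = 1 := by
    intro z hz
    obtain ⟨y, rfl⟩ := QuotientGroup.mk_surjective z
    rw [← QuotientGroup.mk_pow, QuotientGroup.eq_one_iff]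
    intro g
    have h1 := Subgroup.mem_center_iff.1 hz (g : Γ ⧸ K)
    rw [← QuotientGroup.mk_mul, ← QuotientGroup.mk_mul, QuotientGroup.eq] at h1
    obtain ⟨μ, hμ⟩ := exists_eq_smul_one_of_commute hirr h1
    have h2 : ρ y * ρ g = μ • (ρ g * ρ y) := by
      rw [← map_mul, show y * g = (g * y) * ((g * y)⁻¹ * (y * g)) by group, map_mul, hμ, map_mul]
      simp
    have hμ1 : μ ^ Module.finrank ℂ V = 1 := by
      have := congrArg LinearMap.det h2
      rw [LinearMap.det_smul, map_mul, map_mul, mul_comm (LinearMap.det (ρ y))] at this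
      exact (mul_eq_right₀ (mul_ne_zero (hdet g) (hdet y))).1 this.symm
    have h3 : ∀ j : ℕ, ρ y ^ j * ρ g = μ ^ j • (ρ g * ρ y ^ j) := fun j => by
      induction j with
      | zero => simp
      | succ j ih =>
        rw [pow_succ', mul_assoc, ih, mul_smul_comm, ← mul_assoc, h2, smul_mul_assoc, smul_smul,
          mul_assoc, pow_succ]
    rw [map_pow, Commute, SemiconjBy, h3, hμ1, one_smul]
  obtain ⟨N, hN, hx⟩ := Group.IsNilpotent.exists_pow_eq_one_of_center Module.finrank_pos (Γ ⧸ K)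
    hcenter (x : Γ ⧸ K)
  rw [← QuotientGroup.mk_pow, QuotientGroup.eq_one_iff] at hx
  refine ⟨N, hN, ?_⟩
  rw [← map_pow]
  exact exists_eq_smul_one_of_commute hirr hx

theorem existsNormalizingForm_of_irreducible [Group.IsNilpotent Γ] [FiniteDimensional ℂ V]
    [Nontrivial V] {ρ : Γ →* Module.End ℂ V}
    (hirr : ∀ W : Submodule ℂ V, (∀ γ, ∀ w ∈ W, ρ γ w ∈ W) → W = ⊥ ∨ W = ⊤) :
    ExistsNormalizingForm ρ := by
  have hinv : ∀ γ, ρ γ * ρ γ⁻¹ = 1 := fun γ => by rw [← map_mul]; simp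
  have hinv' : ∀ γ, ρ γ⁻¹ * ρ γ = 1 := fun γ => by rw [← map_mul]; simp
  have hdet : ∀ γ, LinearMap.det (ρ γ) ≠ 0 := fun γ h => by
    have := congrArg LinearMap.det (hinv γ)
    simp [h] at this
  have hd : (Module.finrank ℂ V : ℝ) ≠ 0 := by exact_mod_cast Module.finrank_pos.ne'
  let s : Γ → ℝ := fun γ => ‖LinearMap.det (ρ γ)‖ ^ (2 / Module.finrank ℂ V : ℝ)
  have hs : ∀ γ, 0 < s γ := fun γ => Real.rpow_pos_of_pos (norm_pos_iff.2 (hdet γ)) _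
  have hs1 : s 1 = 1 := by simp [s]
  have hsmul : ∀ a b, s (a * b) = s a * s b := fun a b => by
    simp only [s, map_mul, norm_mul]
    exact Real.mul_rpow (norm_nonneg _) (norm_nonneg _)
  have hsscalar : ∀ γ (μ : ℂ), ρ γ = μ • 1 → s γ = ‖μ‖ ^ 2 := fun γ μ h => by
    simp only [s, h, LinearMap.det_smul, map_one, mul_one, norm_pow]
    rw [← Real.rpow_natCast, ← Real.rpow_mul (norm_nonneg _), mul_div_cancel₀ _ hd]
    exact_mod_cast Real.rpow_natCast ‖μ‖ 2
  let τ : Γ →* Module.End ℂ (Module.End ℂ V) :=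
    { toFun := fun γ =>
        { toFun := fun h => (s γ : ℂ) • (LinearMap.adjoint (ρ γ⁻¹) * h * ρ γ⁻¹)
          map_add' := fun a b => by simp [mul_add, add_mul]
          map_smul' := fun c a => by simp [smul_comm c] }
      map_one' := by
        ext1 h
        have : LinearMap.adjoint (1 : Module.End ℂ V) = 1 := star_one (Module.End ℂ V)
        simp [hs1, this]
      map_mul' := fun a b => by
        ext1 h
        have : ∀ S T : Module.End ℂ V, LinearMap.adjoint (S * T) =
          LinearMap.adjoint T * LinearMap.adjoint S := fun S T => star_mul S T
        change (s (a * b) : ℂ) • (LinearMap.adjoint (ρ (a * b)⁻¹) * h * ρ (a * b)⁻¹) =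
          (s a : ℂ) • (LinearMap.adjoint (ρ a⁻¹) *
            ((s b : ℂ) • (LinearMap.adjoint (ρ b⁻¹) * h * ρ b⁻¹)) * ρ a⁻¹)
        rw [hsmul, _root_.mul_inv_rev, map_mul, this, mul_smul_comm, smul_mul_assoc, smul_smul,
          Complex.ofReal_mul]
        simp only [mul_assoc] }
  have hτ : ∀ γ h, τ γ h = (s γ : ℂ) • (LinearMap.adjoint (ρ γ⁻¹) * h * ρ γ⁻¹) := fun _ _ => rfl
  have hτinner : ∀ γ h v w, ⟪τ γ h v, w⟫_ℂ = (s γ : ℂ) * ⟪h (ρ γ⁻¹ v), ρ γ⁻¹ w⟫_ℂ :=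
    fun γ h v w => by
      rw [hτ, LinearMap.smul_apply, inner_smul_left, Module.End.mul_apply, Module.End.mul_apply,
        LinearMap.adjoint_inner_left, Complex.conj_ofReal]
  obtain ⟨h, ⟨hsym, hpos⟩, hfix⟩ := exists_fixed_of_isNilpotent τ (fun γ => by
      obtain ⟨N, hN, μ, hμ⟩ := exists_pow_eq_smul_one hirr γ⁻¹
      refine ⟨N, hN, ?_⟩
      rw [← map_pow] at hμ ⊢
      have h1 := hsscalar _ _ hμ
      have h2 : s (γ ^ N) * s (γ⁻¹ ^ N) = 1 := by rw [← hsmul]; simp [hs1]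
      ext1 h
      refine LinearMap.ext fun v => ext_inner_right ℂ fun w => ?_
      rw [hτinner, ← inv_pow, hμ]
      simp only [LinearMap.smul_apply, Module.End.one_apply, map_smul, inner_smul_left,
        inner_smul_right]
      rw [← mul_assoc, ← mul_assoc, mul_assoc (s (γ ^ N) : ℂ), Complex.mul_conj',
        ← Complex.ofReal_pow, ← h1, ← Complex.ofReal_mul, h2]
      simp)
    {h | h.IsSymmetric ∧ ∀ v, v ≠ 0 → 0 < (⟪h v, v⟫_ℂ).re}
    ⟨1, LinearMap.IsSymmetric.id, fun v hv => by
      have := norm_pos_iff.2 hv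
      have h2 : (⟪v, v⟫_ℂ).re = ‖v‖ ^ 2 := inner_self_eq_norm_sq (𝕜 := ℂ) v
      rw [Module.End.one_apply, h2]
      positivity⟩
    (fun a ha b hb => ⟨ha.1.add hb.1, fun v hv => by
      rw [LinearMap.add_apply, inner_add_left, Complex.add_re]
      exact add_pos (ha.2 v hv) (hb.2 v hv)⟩)
    (fun γ a ha => ⟨fun v w => by
      rw [hτinner, ← inner_conj_symm v, hτinner, ha.1, map_mul, inner_conj_symm,
        Complex.conj_ofReal], fun v hv => by
      rw [hτinner, Complex.re_ofReal_mul]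
      refine mul_pos (hs γ) (ha.2 _ fun h0 => hv ?_)
      rw [← Module.End.one_apply (R := ℂ) v, ← hinv γ, Module.End.mul_apply, h0, map_zero]⟩)
  refine ⟨h, hsym, hpos, fun γ => ⟨(s γ : ℂ) • 1, (Commute.one_left _).smul_left _,
    fun v w => ?_⟩⟩
  conv_rhs => rw [LinearMap.smul_apply, inner_smul_right, Module.End.one_apply]
  conv_lhs => rw [← hfix γ, hτinner]
  rw [← Module.End.mul_apply (ρ γ⁻¹), ← Module.End.mul_apply (ρ γ⁻¹), hinv']
  rfl

/-- If the orthogonal complement of every invariant subspace is invariant, then the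
representation of a nilpotent group is normal for some inner product. -/
theorem existsNormalizingForm_of_orthogonal_invariant [Group.IsNilpotent Γ]
    (V : Type*) [NormedAddCommGroup V] [InnerProductSpace ℂ V] [FiniteDimensional ℂ V]
    (ρ : Γ →* Module.End ℂ V)
    (hss : ∀ W : Submodule ℂ V, (∀ γ, ∀ w ∈ W, ρ γ w ∈ W) → ∀ γ, ∀ w ∈ Wᗮ, ρ γ w ∈ Wᗮ) :
    ExistsNormalizingForm ρ := by
  induction hd : Module.finrank ℂ V using Nat.strong_induction_on generalizing V with
  | _ d ih =>
  rcases subsingleton_or_nontrivial V with hV | hV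
  · exact ⟨1, LinearMap.IsSymmetric.id, fun v hv => (hv (Subsingleton.elim _ _)).elim,
      fun γ => ⟨1, Commute.one_left _, fun v w => by
        rw [Subsingleton.elim v 0]; simp⟩⟩
  by_cases hirr : ∀ W : Submodule ℂ V, (∀ γ, ∀ w ∈ W, ρ γ w ∈ W) → W = ⊥ ∨ W = ⊤
  · exact existsNormalizingForm_of_irreducible hirr
  push Not at hirr
  obtain ⟨W, hW, hbot, htop⟩ := hirr
  have restr : ∀ U : Submodule ℂ V, (∀ γ, ∀ w ∈ U, ρ γ w ∈ U) → U ≠ ⊤ →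
      ∃ σ : Γ →* Module.End ℂ U, (∀ γ u, (σ γ u : V) = ρ γ u) ∧ ExistsNormalizingForm σ := by
    intro U hU hUtop
    let σ : Γ →* Module.End ℂ U :=
      { toFun := fun γ => (ρ γ).restrict (hU γ)
        map_one' := by ext; simp
        map_mul' := fun a b => by ext; simp }
    refine ⟨σ, fun _ _ => rfl, ih _ ?_ U σ ?_ rfl⟩
    · rw [← hd]; exact Submodule.finrank_lt hUtop
    · intro X hX γ w hw
      have h1 := hss (X.map U.subtype) (by
        rintro g _ ⟨x, hx, rfl⟩
        exact ⟨σ g x, hX g x hx, rfl⟩) γ w (by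
        rintro _ ⟨x, hx, rfl⟩
        exact hw x hx)
      exact fun x hx => h1 x ⟨x, hx, rfl⟩
  obtain ⟨σ₁, hσ₁, h₁, hsym₁, hpos₁, hA₁⟩ := restr W hW htop
  obtain ⟨σ₂, hσ₂, h₂, hsym₂, hpos₂, hA₂⟩ := restr Wᗮ (hss W hW) fun h => hbot (by
    rw [← Submodule.orthogonal_orthogonal W, h, Submodule.top_orthogonal_eq_bot])
  let p : V →ₗ[ℂ] W := W.orthogonalProjectionOnto
  let q : V →ₗ[ℂ] Wᗮ := Wᗮ.orthogonalProjectionOnto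
  have hpq : ∀ v, (p v : V) + q v = v := fun v => W.starProjection_add_starProjection_orthogonal v
  have hpW : ∀ w : W, p w = w := fun w => W.orthogonalProjectionOnto_mem_subspace_eq_self w
  have hqW : ∀ w : Wᗮ, q w = w := fun w => Wᗮ.orthogonalProjectionOnto_mem_subspace_eq_self w
  have hpW' : ∀ w : Wᗮ, p w = 0 := fun w =>
    Submodule.orthogonalProjectionOnto_eq_zero_iff.2 w.2
  have hqW' : ∀ w : W, q w = 0 := fun w =>
    Submodule.orthogonalProjectionOnto_eq_zero_iff.2 (W.le_orthogonal_orthogonal w.2)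
  have hip : ∀ (x : W) v, ⟪(x : V), v⟫_ℂ = ⟪x, p v⟫_ℂ := fun x v =>
    (W.inner_orthogonalProjectionOnto_eq_of_mem_left x v).symm
  have hiq : ∀ (x : Wᗮ) v, ⟪(x : V), v⟫_ℂ = ⟪x, q v⟫_ℂ := fun x v =>
    (Wᗮ.inner_orthogonalProjectionOnto_eq_of_mem_left x v).symm
  have hρ : ∀ γ v, ρ γ v = (σ₁ γ (p v) : V) + σ₂ γ (q v) := fun γ v => by
    rw [hσ₁, hσ₂, ← map_add, hpq]
  have hpadd : ∀ (x : W) (y : Wᗮ), p (x + y : V) = x := fun x y => by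
    rw [map_add, hpW, hpW', add_zero]
  have hqadd : ∀ (x : W) (y : Wᗮ), q (x + y : V) = y := fun x y => by
    rw [map_add, hqW, hqW', zero_add]
  let glue : Module.End ℂ W → Module.End ℂ Wᗮ → Module.End ℂ V := fun a b =>
    W.subtype ∘ₗ a ∘ₗ p + Wᗮ.subtype ∘ₗ b ∘ₗ q
  have hglue : ∀ a b v, glue a b v = (a (p v) : V) + b (q v) := fun _ _ _ => rfl
  have hinner : ∀ a b v w, ⟪glue a b v, w⟫_ℂ = ⟪a (p v), p w⟫_ℂ + ⟪b (q v), q w⟫_ℂ :=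
    fun a b v w => by rw [hglue, inner_add_left, hip, hiq]
  refine ⟨glue h₁ h₂, fun v w => ?_, fun v hv => ?_, fun γ => ?_⟩
  · rw [hinner, ← inner_conj_symm v, hinner, map_add, inner_conj_symm, inner_conj_symm, hsym₁,
      hsym₂]
  · rw [hinner, Complex.add_re]
    have n₁ : 0 ≤ (⟪h₁ (p v), p v⟫_ℂ).re := by
      by_cases h0 : p v = 0
      · simp [h0]
      · exact (hpos₁ _ h0).le
    have n₂ : 0 ≤ (⟪h₂ (q v), q v⟫_ℂ).re := by
      by_cases h0 : q v = 0
      · simp [h0]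
      · exact (hpos₂ _ h0).le
    by_cases h0 : p v = 0
    · have h0' : q v ≠ 0 := fun h => hv (by rw [← hpq v, h0, h]; simp)
      linarith [hpos₂ _ h0']
    · linarith [hpos₁ _ h0]
  · obtain ⟨A₁, hc₁, hA₁⟩ := hA₁ γ
    obtain ⟨A₂, hc₂, hA₂⟩ := hA₂ γ
    refine ⟨glue A₁ A₂, LinearMap.ext fun v => ?_, fun v w => ?_⟩
    · rw [Module.End.mul_apply, Module.End.mul_apply, hρ, hglue, hglue, hρ, hpadd, hqadd, hpadd,
        hqadd, ← Module.End.mul_apply, hc₁.eq, ← Module.End.mul_apply A₂, hc₂.eq]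
      rfl
    · rw [hinner, hinner, hρ, hρ, hglue, hpadd, hqadd, hpadd, hqadd, hpadd, hqadd, hA₁, hA₂]

end Forms

section Frobenius

open scoped ComplexOrder

variable {n : ℕ}

theorem sqFrobNorm_eq_re_trace (m : Matrix (Fin n) (Fin n) ℂ) :
    sqFrobNorm m = (trace (mᴴ * m)).re := by
  rw [sqFrobNorm, trace, Complex.re_sum, Finset.sum_comm]
  refine Finset.sum_congr rfl fun j _ => ?_
  rw [diag_apply, mul_apply, Complex.re_sum]
  refine Finset.sum_congr rfl fun i _ => ?_
  rw [conjTranspose_apply, Complex.star_def, Complex.conj_mul', ← Complex.ofReal_pow,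
    Complex.ofReal_re]

theorem sqFrobNorm_nonneg (m : Matrix (Fin n) (Fin n) ℂ) : 0 ≤ sqFrobNorm m :=
  Finset.sum_nonneg fun _ _ => Finset.sum_nonneg fun _ _ => sq_nonneg _

theorem sqFrobNorm_eq_zero {m : Matrix (Fin n) (Fin n) ℂ} (h : sqFrobNorm m = 0) : m = 0 := by
  ext i j
  have h1 := (Finset.sum_eq_zero_iff_of_nonneg fun _ _ =>
    Finset.sum_nonneg fun _ _ => sq_nonneg _).1 h i (Finset.mem_univ i)
  have h2 := (Finset.sum_eq_zero_iff_of_nonneg fun _ _ => sq_nonneg _).1 h1 j (Finset.mem_univ j)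
  simpa using h2

theorem sqFrobNorm_smul (t : ℝ) (m : Matrix (Fin n) (Fin n) ℂ) :
    sqFrobNorm ((t : ℂ) • m) = t ^ 2 * sqFrobNorm m := by
  simp [sqFrobNorm, Finset.mul_sum, mul_pow]

theorem sqFrobNorm_add_of_trace_eq_zero {a b : Matrix (Fin n) (Fin n) ℂ}
    (h : trace (aᴴ * b) = 0) : sqFrobNorm (a + b) = sqFrobNorm a + sqFrobNorm b := by
  have h' : trace (bᴴ * a) = 0 := by
    have := congrArg star h
    rwa [← trace_conjTranspose, conjTranspose_mul, conjTranspose_conjTranspose, star_zero] at this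
  simp only [sqFrobNorm_eq_re_trace, conjTranspose_add, mul_add, add_mul, trace_add, h, h',
    Complex.add_re]
  simp

/-- At a tuple of minimal Frobenius norm in its conjugation orbit, an orthogonal projection onto
an invariant subspace commutes with the tuple. -/
theorem commute_projection_of_minimal {ι : Type*} [Fintype ι]
    {m : ι → Matrix (Fin n) (Fin n) ℂ}
    (hmin : ∀ g : (Matrix (Fin n) (Fin n) ℂ)ˣ, ∑ i, sqFrobNorm (m i) ≤
      ∑ i, sqFrobNorm (g.val * m i * (g⁻¹).val))
    {P : Matrix (Fin n) (Fin n) ℂ} (hP : Pᴴ = P) (hPP : P * P = P)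
    (hinv : ∀ i, P * m i * P = m i * P) (i : ι) : Commute P (m i) := by
  let g : (Matrix (Fin n) (Fin n) ℂ)ˣ :=
    { val := 1 - (1 / 2 : ℂ) • P
      inv := 1 + P
      val_inv := by
        simp only [sub_mul, mul_add, smul_mul_assoc, hPP, one_mul, mul_one]
        module
      inv_val := by
        simp only [mul_sub, add_mul, mul_smul_comm, hPP, one_mul, mul_one]
        module }
  let b : ι → Matrix (Fin n) (Fin n) ℂ := fun i => P * m i - m i * P
  have horth : ∀ i, ∀ t : ℂ, trace ((m i - b i)ᴴ * (t • b i)) = 0 := fun i t => by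
    have h1 : (m i - b i)ᴴ = (m i)ᴴ - (m i)ᴴ * P + P * (m i)ᴴ := by
      simp only [b, conjTranspose_sub, conjTranspose_mul, hP]
      abel
    have h2 : b i * P = 0 := by
      simp only [b, sub_mul]
      rw [hinv, mul_assoc (m i), hPP, sub_self]
    have h3 : P * b i = b i := by
      simp only [b, mul_sub, ← mul_assoc, hPP, hinv]
    have h4 : (m i - b i)ᴴ * b i = P * ((m i)ᴴ * b i) := by
      rw [h1, add_mul, sub_mul, mul_assoc (m i)ᴴ, h3, sub_self, zero_add, mul_assoc]
    rw [mul_smul_comm, h4, trace_smul, trace_mul_comm, mul_assoc, h2, mul_zero, trace_zero,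
      smul_zero]
  have hm : ∀ i, sqFrobNorm (m i) = sqFrobNorm (m i - b i) + sqFrobNorm (b i) := fun i => by
    rw [← sqFrobNorm_add_of_trace_eq_zero (by simpa using horth i 1), sub_add_cancel]
  have hg : ∀ i, sqFrobNorm (g.val * m i * (g⁻¹).val) =
      sqFrobNorm (m i - b i) + (1 / 2 : ℝ) ^ 2 * sqFrobNorm (b i) := fun i => by
    rw [← sqFrobNorm_smul, ← sqFrobNorm_add_of_trace_eq_zero (horth i _)]
    congr 1
    change (1 - (1 / 2 : ℂ) • P) * m i * (1 + P) = _
    simp only [b, mul_add, sub_mul, smul_mul_assoc, hinv, one_mul, mul_one]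
    push_cast
    module
  have hsum := hmin g
  simp only [hm, hg, Finset.sum_add_distrib, ← Finset.mul_sum] at hsum
  have hnn : ∀ j ∈ Finset.univ, 0 ≤ sqFrobNorm (b j) := fun j _ => sqFrobNorm_nonneg _
  have h0 : ∑ i, sqFrobNorm (b i) = 0 := by
    have := Finset.sum_nonneg hnn
    linarith
  exact sub_eq_zero.1 (sqFrobNorm_eq_zero
    ((Finset.sum_eq_zero_iff_of_nonneg hnn).1 h0 i (Finset.mem_univ i)))

theorem sum_norm_sq_row_eq_col {m : Matrix (Fin n) (Fin n) ℂ} (hm : m * mᴴ = mᴴ * m)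
    (i : Fin n) : ∑ j, ‖m i j‖ ^ 2 = ∑ j, ‖m j i‖ ^ 2 := by
  have h := congrFun (congrFun hm i) i
  simp only [mul_apply, conjTranspose_apply, Complex.star_def, Complex.mul_conj',
    Complex.conj_mul'] at h
  exact_mod_cast h

/-- For a matrix whose squared moduli have equal row and column sums, rescaling the entries by
`d j / d i` does not decrease their sum; in case of equality, `d` is constant along the support. -/
theorem sum_norm_sq_le_sum_div {m : Matrix (Fin n) (Fin n) ℂ} (hm : m * mᴴ = mᴴ * m)
    {d : Fin n → ℝ} (hd : ∀ i, 0 < d i) :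
    sqFrobNorm m ≤ ∑ i, ∑ j, ‖m i j‖ ^ 2 * (d j / d i) ∧
      (sqFrobNorm m = ∑ i, ∑ j, ‖m i j‖ ^ 2 * (d j / d i) →
        m * diagonal (fun i => (d i : ℂ)) = diagonal (fun i => (d i : ℂ)) * m) := by
  have hlog : ∑ i, ∑ j, ‖m i j‖ ^ 2 * (1 + Real.log (d j / d i)) = sqFrobNorm m := by
    have h1 : ∀ i j, ‖m i j‖ ^ 2 * (1 + Real.log (d j / d i)) =
        ‖m i j‖ ^ 2 + (‖m i j‖ ^ 2 * Real.log (d j) - ‖m i j‖ ^ 2 * Real.log (d i)) :=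
      fun i j => by rw [Real.log_div (hd j).ne' (hd i).ne']; ring
    simp only [h1, Finset.sum_add_distrib, Finset.sum_sub_distrib]
    rw [Finset.sum_comm (f := fun i j => ‖m i j‖ ^ 2 * Real.log (d j))]
    simp only [← Finset.sum_mul, sum_norm_sq_row_eq_col hm, sub_self, add_zero]
    rw [sqFrobNorm, Finset.sum_comm]
  have hle : ∀ i j, ‖m i j‖ ^ 2 * (1 + Real.log (d j / d i)) ≤ ‖m i j‖ ^ 2 * (d j / d i) :=
    fun i j => mul_le_mul_of_nonneg_left
      (by linarith [Real.log_le_sub_one_of_pos (div_pos (hd j) (hd i))]) (sq_nonneg _)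
  refine ⟨hlog ▸ Finset.sum_le_sum fun i _ => Finset.sum_le_sum fun j _ => hle i j, fun heq => ?_⟩
  rw [← hlog] at heq
  ext i j
  have h1 := (Finset.sum_eq_sum_iff_of_le fun i _ => Finset.sum_le_sum fun j _ => hle i j).1 heq i
    (Finset.mem_univ i)
  have h2 := (Finset.sum_eq_sum_iff_of_le fun j _ => hle i j).1 h1 j (Finset.mem_univ j)
  rw [mul_diagonal, diagonal_mul]
  by_cases h0 : m i j = 0
  · simp [h0]
  have h3 : 1 + Real.log (d j / d i) = d j / d i := mul_left_cancel₀ (by positivity) h2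
  have h4 : d j / d i = 1 := by
    by_contra hne
    linarith [Real.log_lt_sub_one_of_pos (div_pos (hd j) (hd i)) hne]
  rw [(div_eq_one_iff_eq (hd i).ne').1 h4, mul_comm]

/-- A normal matrix has minimal Frobenius norm in its conjugacy class, and conjugating by `k`
preserves its norm only if it commutes with `k * kᴴ`. -/
theorem sqFrobNorm_le_conj_of_normal {m : Matrix (Fin n) (Fin n) ℂ} (hm : m * mᴴ = mᴴ * m)
    (k : (Matrix (Fin n) (Fin n) ℂ)ˣ) :
    sqFrobNorm m ≤ sqFrobNorm ((k⁻¹).val * m * k.val) ∧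
      (sqFrobNorm m = sqFrobNorm ((k⁻¹).val * m * k.val) →
        Commute m (k.val * k.valᴴ)) := by
  set K : Matrix (Fin n) (Fin n) ℂ := k.val with hK
  set L : Matrix (Fin n) (Fin n) ℂ := (k⁻¹).val with hL
  have hLK : L * K = 1 := k.inv_mul
  have hpd : (K * Kᴴ).PosDef := by
    have h := (posSemidef_self_mul_conjTranspose K)
    exact h.posDef_iff_isUnit.2 (k.isUnit.mul k.isUnit.star)
  set U : Matrix (Fin n) (Fin n) ℂ := hpd.1.eigenvectorUnitary.1 with hU
  have hUU : Uᴴ * U = 1 := Unitary.coe_star_mul_self hpd.1.eigenvectorUnitary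
  have hUU' : U * Uᴴ = 1 := Unitary.coe_mul_star_self hpd.1.eigenvectorUnitary
  set d := hpd.1.eigenvalues with hd
  have hdpos : ∀ i, 0 < d i := hpd.eigenvalues_pos
  set D : Matrix (Fin n) (Fin n) ℂ := diagonal fun i => (d i : ℂ) with hD
  set D' : Matrix (Fin n) (Fin n) ℂ := diagonal fun i => ((d i)⁻¹ : ℂ) with hD'
  have hDD : D' * D = 1 := by
    rw [hD, hD', diagonal_mul_diagonal, ← diagonal_one]
    congr 1; ext i
    exact inv_mul_cancel₀ (by exact_mod_cast (hdpos i).ne')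
  have hspec : K * Kᴴ = U * D * Uᴴ := hpd.1.spectral_theorem
  have hLL : Lᴴ * L = U * D' * Uᴴ := by
    have h1 : (Lᴴ * L) * (K * Kᴴ) = 1 := by
      rw [mul_assoc, ← mul_assoc L, hLK, one_mul, ← conjTranspose_mul,
        mul_eq_one_comm.1 hLK, conjTranspose_one]
    have h2 : (U * D' * Uᴴ) * (K * Kᴴ) = 1 := by
      rw [hspec]
      calc _ = U * D' * (Uᴴ * U) * D * Uᴴ := by simp only [mul_assoc]
        _ = _ := by rw [hUU, mul_one, mul_assoc U, hDD, mul_one, hUU']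
    exact left_inv_eq_right_inv h1 (mul_eq_one_comm.1 h2)
  set m' := Uᴴ * m * U with hm'
  have hm'H : m'ᴴ = Uᴴ * mᴴ * U := by
    rw [hm']; simp only [conjTranspose_mul, conjTranspose_conjTranspose, mul_assoc]
  have hcancel : ∀ X Y : Matrix (Fin n) (Fin n) ℂ,
      (Uᴴ * X * U) * (Uᴴ * Y * U) = Uᴴ * (X * Y) * U := fun X Y => by
    calc _ = Uᴴ * X * (U * Uᴴ) * Y * U := by simp only [mul_assoc]
      _ = _ := by rw [hUU', mul_one]; simp only [mul_assoc]
  have hconj : ∀ X : Matrix (Fin n) (Fin n) ℂ, U * (Uᴴ * X * U) * Uᴴ = X := fun X => by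
    calc _ = (U * Uᴴ) * X * (U * Uᴴ) := by simp only [mul_assoc]
      _ = _ := by rw [hUU', mul_one, one_mul]
  have hm'n : m' * m'ᴴ = m'ᴴ * m' := by rw [hm'H, hm', hcancel, hcancel, hm]
  have e1 : sqFrobNorm m = sqFrobNorm m' := by
    rw [sqFrobNorm_eq_re_trace, sqFrobNorm_eq_re_trace, hm'H, hm', hcancel,
      trace_mul_comm (Uᴴ * (mᴴ * m)) U, ← mul_assoc, hUU', one_mul]
  have e2 : sqFrobNorm (L * m * K) = ∑ i, ∑ j, ‖m' i j‖ ^ 2 * (d j / d i) := by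
    have h1 : trace ((L * m * K)ᴴ * (L * m * K)) = trace (m'ᴴ * (D' * m' * D)) := by
      calc _ = trace (Kᴴ * (mᴴ * (Lᴴ * L) * m * K)) := by
            simp only [conjTranspose_mul, mul_assoc]
        _ = trace (mᴴ * (Lᴴ * L) * m * (K * Kᴴ)) := by rw [trace_mul_comm]; simp only [mul_assoc]
        _ = trace ((mᴴ * U * D' * Uᴴ * m * U * D) * Uᴴ) := by
            rw [hLL, hspec]; simp only [mul_assoc]
        _ = _ := by rw [trace_mul_comm, hm'H, hm']; simp only [mul_assoc]
    rw [sqFrobNorm_eq_re_trace, h1, trace, Complex.re_sum, Finset.sum_comm]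
    refine Finset.sum_congr rfl fun j _ => ?_
    rw [diag_apply, mul_apply, Complex.re_sum]
    refine Finset.sum_congr rfl fun i _ => ?_
    rw [hD, hD', mul_diagonal, diagonal_mul, conjTranspose_apply, Complex.star_def,
      show (starRingEnd ℂ) (m' i j) * ((d i : ℂ)⁻¹ * m' i j * d j) =
        (starRingEnd ℂ) (m' i j) * m' i j * (d j / d i) by ring, Complex.conj_mul']
    norm_cast
  obtain ⟨hle, heq⟩ := sum_norm_sq_le_sum_div hm'n hdpos
  rw [e1, e2]
  refine ⟨hle, fun h => ?_⟩
  have := heq h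
  rw [← hD] at this
  rw [hspec, Commute, SemiconjBy]
  calc m * (U * D * Uᴴ) = U * (m' * D) * Uᴴ := by
        rw [hm']
        conv_lhs => rw [← hconj m]
        calc _ = U * (Uᴴ * m * U) * (Uᴴ * U) * D * Uᴴ := by simp only [mul_assoc]
          _ = _ := by rw [hUU, mul_one]; simp only [mul_assoc]
    _ = U * D * Uᴴ * m := by
        rw [this]
        conv_rhs => rw [← hconj m]
        calc _ = U * D * (Uᴴ * U) * (Uᴴ * m * U) * Uᴴ := by
              rw [hUU, mul_one]; simp only [hm', mul_assoc]
          _ = _ := by simp only [mul_assoc]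

open scoped MatrixOrder in
theorem exists_units_conjTranspose_mul_self {H : Matrix (Fin n) (Fin n) ℂ} (hH : H.PosDef) :
    ∃ k : (Matrix (Fin n) (Fin n) ℂ)ˣ, H = k.valᴴ * k.val := by
  obtain ⟨y, hy⟩ := CStarAlgebra.nonneg_iff_eq_star_mul_self.mp hH.posSemidef.nonneg
  have hu : IsUnit y := by
    have := hH.isUnit
    rw [hy] at this
    exact isUnit_of_mul_isUnit_right this
  obtain ⟨k, rfl⟩ := hu
  exact ⟨k, hy⟩

end Frobenius

section Representation

open scoped ComplexOrder InnerProductSpace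

variable {Γ : Type*} [Group Γ] {n : ℕ}

theorem commute_of_commute_generators {ι : Type*} {c : ι → Γ}
    (hc : Subgroup.closure (Set.range c) = ⊤) (ρ : Γ →* (Matrix (Fin n) (Fin n) ℂ)ˣ)
    {X : Matrix (Fin n) (Fin n) ℂ} (hX : ∀ i, Commute X (ρ (c i)).val) (γ : Γ) :
    Commute X (ρ γ).val := by
  have hγ : γ ∈ Subgroup.closure (Set.range c) := hc ▸ Subgroup.mem_top γ
  induction hγ using Subgroup.closure_induction with
  | mem x hx => obtain ⟨i, rfl⟩ := hx; exact hX i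
  | one => simp
  | mul x y _ _ hx hy => rw [map_mul, Units.val_mul]; exact hx.mul_right hy
  | inv x _ hx => rw [map_inv]; exact hx.units_inv_right

/-- A representation whose generators have minimal Frobenius norm in their conjugation orbit is
normal for some positive definite form `H`. -/
theorem exists_posDef_of_minimal [Group.IsNilpotent Γ] {ι : Type*} [Fintype ι] {c : ι → Γ}
    (hc : Subgroup.closure (Set.range c) = ⊤) (ρ : Γ →* (Matrix (Fin n) (Fin n) ℂ)ˣ)
    (hmin : ∀ g : (Matrix (Fin n) (Fin n) ℂ)ˣ, ∑ i, sqFrobNorm (ρ (c i)).val ≤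
      ∑ i, sqFrobNorm (g.val * (ρ (c i)).val * (g⁻¹).val)) :
    ∃ H : Matrix (Fin n) (Fin n) ℂ, H.PosDef ∧ ∀ γ, ∃ A, Commute A (ρ γ).val ∧
      (ρ γ).valᴴ * H * (ρ γ).val = H * A := by
  let e := LinearMap.toMatrixOrthonormal (EuclideanSpace.basisFun (Fin n) ℂ)
  let σ : Γ →* Module.End ℂ (EuclideanSpace ℂ (Fin n)) :=
    (e.symm : Matrix (Fin n) (Fin n) ℂ →* Module.End ℂ (EuclideanSpace ℂ (Fin n))).comp
      ((Units.coeHom _).comp ρ)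
  have heσ : ∀ γ, e (σ γ) = (ρ γ).val := fun γ => e.apply_symm_apply _
  have hss : ∀ W : Submodule ℂ (EuclideanSpace ℂ (Fin n)), (∀ γ, ∀ w ∈ W, σ γ w ∈ W) →
      ∀ γ, ∀ w ∈ Wᗮ, σ γ w ∈ Wᗮ := by
    intro W hW γ w hw
    let p : Module.End ℂ (EuclideanSpace ℂ (Fin n)) := W.starProjection
    have hp : star p = p := LinearMap.IsSymmetric.adjoint_eq W.starProjection_isSymmetric
    have hpp : p * p = p := LinearMap.ext fun v =>
      Submodule.starProjection_eq_self_iff.2 (W.starProjection_apply_mem v)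
    have hpσ : ∀ γ, p * σ γ * p = σ γ * p := fun γ => LinearMap.ext fun v =>
      Submodule.starProjection_eq_self_iff.2 (hW γ _ (W.starProjection_apply_mem v))
    have hcomm := commute_of_commute_generators hc ρ (X := e p) (commute_projection_of_minimal hmin
      (by rw [← star_eq_conjTranspose, ← map_star, hp]) (by rw [← map_mul, hpp])
      fun i => by rw [← heσ, ← map_mul, ← map_mul, hpσ, map_mul]) γ
    have hcomm' : p * σ γ = σ γ * p :=
      EquivLike.injective e (by rw [map_mul, map_mul, heσ]; exact hcomm)
    have hpw : p w = 0 := (W.starProjection_apply_eq_zero_iff).2 hw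
    refine (W.starProjection_apply_eq_zero_iff).1 ?_
    change (p * σ γ) w = 0
    rw [hcomm', Module.End.mul_apply, hpw, map_zero]
  obtain ⟨h, hsym, hpos, hA⟩ := existsNormalizingForm_of_orthogonal_invariant _ σ hss
  have hstar : star h = h := hsym.adjoint_eq
  refine ⟨e h, ?_, fun γ => ?_⟩
  · have hps : (e h).PosSemidef :=
      (LinearMap.posSemidef_toMatrix_iff (EuclideanSpace.basisFun (Fin n) ℂ)).2 ⟨hsym, fun v => by
        by_cases hv : v = 0
        · simp [hv]
        · exact (hpos v hv).le⟩
    refine hps.posDef_iff_isUnit.2 (IsUnit.map e ((LinearMap.isUnit_iff_ker_eq_bot h).2 ?_))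
    refine LinearMap.ker_eq_bot'.2 fun v hv => ?_
    by_contra hne
    simpa [hv] using hpos v hne
  · obtain ⟨A, hcA, hAγ⟩ := hA γ
    refine ⟨e A, by rw [← heσ]; exact hcA.map e, ?_⟩
    have h1 : star (σ γ) * h * σ γ = star A * h := LinearMap.ext fun v =>
      ext_inner_right ℂ fun w => by
        rw [mul_assoc, Module.End.mul_apply, Module.End.mul_apply, Module.End.mul_apply,
          LinearMap.star_eq_adjoint, LinearMap.star_eq_adjoint, LinearMap.adjoint_inner_left,
          LinearMap.adjoint_inner_left, hAγ]
    have h2 := congrArg star h1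
    simp only [star_mul, star_star, hstar] at h2
    rw [← heσ, ← star_eq_conjTranspose, ← map_star, ← map_mul, ← map_mul, ← map_mul, mul_assoc, h2]

theorem Units.normal_of_commute {u : (Matrix (Fin n) (Fin n) ℂ)ˣ}
    (h : Commute (u.valᴴ * u.val) u.val) : u.val * u.valᴴ = u.valᴴ * u.val := by
  refine u.isUnit.mul_right_cancel ?_
  rw [mul_assoc]
  exact h.eq.symm

end Representation


/-- Theorem III of the paper for `G = GL_n ℂ`: a representation `ρ` of a finitely generated
nilpotent group `Γ` in `GL_n ℂ` lies in the Kempf–Ness set (its tuple of generator images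
has minimal Frobenius norm within its orbit under simultaneous conjugation) if and only if
every `ρ(γ)` is a normal matrix. -/
theorem theoremIII_GL (Γ : Type) [Group Γ] [Group.IsNilpotent Γ]
    (r n : ℕ) (hn : 1 ≤ n) (c : Fin r → Γ) (hc : Subgroup.closure (Set.range c) = ⊤)
    (ρ : Γ →* (Matrix (Fin n) (Fin n) ℂ)ˣ) :
    (∀ g : (Matrix (Fin n) (Fin n) ℂ)ˣ,
        ∑ i, sqFrobNorm ((g : Matrix (Fin n) (Fin n) ℂ) * (ρ (c i) : Matrix (Fin n) (Fin n) ℂ) *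
            ((g⁻¹ : (Matrix (Fin n) (Fin n) ℂ)ˣ) : Matrix (Fin n) (Fin n) ℂ)) ≥
          ∑ i, sqFrobNorm (ρ (c i) : Matrix (Fin n) (Fin n) ℂ)) ↔
      (∀ γ : Γ, (ρ γ : Matrix (Fin n) (Fin n) ℂ) * (ρ γ : Matrix (Fin n) (Fin n) ℂ)ᴴ =
          (ρ γ : Matrix (Fin n) (Fin n) ℂ)ᴴ * (ρ γ : Matrix (Fin n) (Fin n) ℂ)) := by
  refine ⟨fun hmin γ => ?_, fun hnormal g => ?_⟩
  · obtain ⟨H, hH, hA⟩ := exists_posDef_of_minimal hc ρ hmin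
    obtain ⟨k, hk⟩ := exists_units_conjTranspose_mul_self hH
    have hkk : (k⁻¹).val * k.val = 1 := k.inv_mul
    have hkk' : k.val * (k⁻¹).val = 1 := k.mul_inv
    have hconj : ∀ i, (k⁻¹).val * (k.val * (ρ (c i)).val * (k⁻¹).val) * k.val = (ρ (c i)).val :=
      fun i => by simp only [mul_assoc, hkk, mul_one]; rw [← mul_assoc, hkk, one_mul]
    have hnormal : ∀ i, (k.val * (ρ (c i)).val * (k⁻¹).val) * (k.val * (ρ (c i)).val * (k⁻¹).val)ᴴ =
        (k.val * (ρ (c i)).val * (k⁻¹).val)ᴴ * (k.val * (ρ (c i)).val * (k⁻¹).val) := by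
      intro i
      obtain ⟨A, hcA, hA⟩ := hA (c i)
      have hnA : (k.val * (ρ (c i)).val * (k⁻¹).val)ᴴ * (k.val * (ρ (c i)).val * (k⁻¹).val) =
          k.val * A * (k⁻¹).val := by
        have hkH : (k⁻¹).valᴴ * k.valᴴ = 1 := by
          rw [← conjTranspose_mul, hkk', conjTranspose_one]
        calc _ = (k⁻¹).valᴴ * ((ρ (c i)).valᴴ * H * (ρ (c i)).val) * (k⁻¹).val := by
              simp only [conjTranspose_mul, hk, mul_assoc]
          _ = (k⁻¹).valᴴ * k.valᴴ * (k.val * A * (k⁻¹).val) := by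
              rw [hA, hk]; simp only [mul_assoc]
          _ = _ := by rw [hkH, one_mul]
      have hcu : Commute (k.val * A * (k⁻¹).val) (k.val * (ρ (c i)).val * (k⁻¹).val) :=
        by
          rw [Commute, SemiconjBy]
          calc _ = k.val * (A * (ρ (c i)).val) * (k⁻¹).val := by
                simp only [mul_assoc]; rw [← mul_assoc (k⁻¹).val k.val, hkk, one_mul]
            _ = _ := by
                rw [hcA.eq]; simp only [mul_assoc]; rw [← mul_assoc (k⁻¹).val k.val, hkk, one_mul]
      exact Units.normal_of_commute (u := k * ρ (c i) * k⁻¹) (by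
        simpa only [Units.val_mul, hnA] using hcu)
    have hle : ∀ i ∈ Finset.univ, sqFrobNorm (k.val * (ρ (c i)).val * (k⁻¹).val) ≤
        sqFrobNorm (ρ (c i)).val := fun i _ => by
      have := (sqFrobNorm_le_conj_of_normal (hnormal i) k).1
      rwa [hconj] at this
    have heq := (Finset.sum_eq_sum_iff_of_le hle).1
      (le_antisymm (Finset.sum_le_sum hle) (hmin k))
    have hHcomm : ∀ i, Commute H (ρ (c i)).val := fun i => by
      have h1 := ((sqFrobNorm_le_conj_of_normal (hnormal i) k).2
        (by rw [hconj]; exact heq i (Finset.mem_univ i))).eq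
      have h2 : (ρ (c i)).val * k.valᴴ = k.valᴴ * (k.val * (ρ (c i)).val * (k⁻¹).val) := by
        refine k.isUnit.mul_left_cancel ?_
        rw [← mul_assoc k.val k.valᴴ]
        refine Eq.trans ?_ h1
        simp only [mul_assoc]
        rw [← mul_assoc (k⁻¹).val k.val, hkk, one_mul]
      rw [Commute, SemiconjBy, hk, ← mul_assoc, h2]
      simp only [mul_assoc, hkk, mul_one]
    have hHγ := commute_of_commute_generators hc ρ hHcomm γ
    obtain ⟨A, hcA, hA⟩ := hA γ
    have hAγ : (ρ γ).valᴴ * (ρ γ).val = A := by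
      have hHu : IsUnit H := by rw [hk]; exact k.isUnit.star.mul k.isUnit
      refine hHu.mul_left_cancel ?_
      have h2 := congrArg conjTranspose hHγ.eq
      have hHH : Hᴴ = H := by rw [hk]; exact isHermitian_conjTranspose_mul_self _
      rw [conjTranspose_mul, conjTranspose_mul, hHH] at h2
      rw [← hA, ← mul_assoc, h2]
    exact Units.normal_of_commute (hAγ ▸ hcA)
  · refine Finset.sum_le_sum fun i _ => ?_
    have := (sqFrobNorm_le_conj_of_normal (hnormal (c i)) g⁻¹).1
    rwa [inv_inv] at this
end

section
/- Let Γ be a nilpotent group generated by finitely many elements γ₁, …, γ_r, let n ≥ 1, and let ρ : Γ → GL_n(ℝ) be a group homomorphism. Then the following are equivalent: (1) for every g ∈ GL_n(ℝ), ∑_{i=1}^r ‖g·ρ(γᵢ)·g⁻¹‖² ≥ ∑_{i=1}^r ‖ρ(γᵢ)‖², where ‖·‖ is the Frobenius norm; (2) ρ(γ)·ρ(γ)ᵀ = ρ(γ)ᵀ·ρ(γ) for every γ ∈ Γ, i.e. every ρ(γ) is a normal real matrix. -/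
open Matrix

/-- The squared Frobenius norm `‖m‖² = ∑ i j, |m i j|²` of a real matrix. -/
noncomputable def sqFrobNormR {n : ℕ} (m : Matrix (Fin n) (Fin n) ℝ) : ℝ :=
  ∑ i, ∑ j, ‖m i j‖ ^ 2

namespace KempfNess

open scoped commutatorElement

variable {n : ℕ} {ι : Type*} [Fintype ι]

theorem sqFrobNormR_eq_trace (m : Matrix (Fin n) (Fin n) ℝ) :
    sqFrobNormR m = (m * mᵀ).trace := by
  simp [sqFrobNormR, trace, mul_apply, pow_two]

theorem sqFrobNormR_eq_trace' (m : Matrix (Fin n) (Fin n) ℝ) :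
    sqFrobNormR m = (mᵀ * m).trace := by
  rw [sqFrobNormR_eq_trace, trace_mul_comm]

theorem exists_orthogonal_diagonalization {S : Matrix (Fin n) (Fin n) ℝ} (hS : Sᵀ = S) :
    ∃ (U : Matrix (Fin n) (Fin n) ℝ) (d : Fin n → ℝ),
      Uᵀ * U = 1 ∧ U * Uᵀ = 1 ∧ S = U * diagonal d * Uᵀ := by
  have hH : S.IsHermitian := by rw [IsHermitian, conjTranspose_eq_transpose_of_trivial, hS]
  refine ⟨hH.eigenvectorUnitary, hH.eigenvalues, ?_, ?_, ?_⟩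
  · simpa [star_eq_conjTranspose] using Unitary.coe_star_mul_self hH.eigenvectorUnitary
  · simpa [star_eq_conjTranspose] using Unitary.coe_mul_star_self hH.eigenvectorUnitary
  · conv_lhs => rw [hH.spectral_theorem, Unitary.conjStarAlgAut_apply]
    simp [star_eq_conjTranspose]

theorem exists_diagonalization_transpose_mul_self (g : (Matrix (Fin n) (Fin n) ℝ)ˣ) :
    ∃ (U : Matrix (Fin n) (Fin n) ℝ) (d : Fin n → ℝ), (∀ i, 0 < d i) ∧
      Uᵀ * U = 1 ∧ U * Uᵀ = 1 ∧ (g.val)ᵀ * g.val = U * diagonal d * Uᵀ := by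
  obtain ⟨U, d, h1, h2, h3⟩ := exists_orthogonal_diagonalization
    (S := (g.val)ᵀ * g.val) (by simp)
  refine ⟨U, d, fun i => ?_, h1, h2, h3⟩
  have hd : (g.val * U)ᵀ * (g.val * U) = diagonal d := by
    calc (g.val * U)ᵀ * (g.val * U) = Uᵀ * ((g.val)ᵀ * g.val) * U := by
          simp only [transpose_mul, Matrix.mul_assoc]
      _ = (Uᵀ * U) * diagonal d * (Uᵀ * U) := by rw [h3]; simp only [Matrix.mul_assoc]
      _ = diagonal d := by rw [h1, Matrix.one_mul, Matrix.mul_one]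
  have hi : d i = ∑ k, (g.val * U) k i ^ 2 := by
    rw [← diagonal_apply_eq d i, ← hd, mul_apply]
    simp only [transpose_apply, pow_two]
  rw [hi]
  refine lt_of_le_of_ne (Finset.sum_nonneg fun k _ => sq_nonneg _) fun h0 => ?_
  have hz := (Finset.sum_eq_zero_iff_of_nonneg fun k _ => sq_nonneg _).1 h0.symm
  have hinv : (Uᵀ * g⁻¹.val) * (g.val * U) = 1 := by
    rw [Matrix.mul_assoc, ← Matrix.mul_assoc g⁻¹.val, ← Units.val_mul, inv_mul_cancel,
      Units.val_one, Matrix.one_mul, h1]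
  have := congrFun (congrFun hinv i) i
  rw [mul_apply, one_apply_eq, Finset.sum_eq_zero] at this
  · exact zero_ne_one this
  · intro k hk
    rw [pow_eq_zero_iff two_ne_zero |>.1 (hz k hk), mul_zero]

theorem sqFrobNormR_conj {g : (Matrix (Fin n) (Fin n) ℝ)ˣ} {U : Matrix (Fin n) (Fin n) ℝ}
    {d : Fin n → ℝ} (hd : ∀ i, 0 < d i) (h1 : Uᵀ * U = 1) (h2 : U * Uᵀ = 1)
    (hg : (g.val)ᵀ * g.val = U * diagonal d * Uᵀ) (A : Matrix (Fin n) (Fin n) ℝ) :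
    sqFrobNormR (g.val * A * g⁻¹.val) =
      ∑ i, ∑ j, (Uᵀ * A * U) i j ^ 2 * (d i / d j) := by
  have hdd : diagonal d * diagonal (fun i => (d i)⁻¹) = 1 := by
    rw [diagonal_mul_diagonal, ← diagonal_one]
    congr 1; ext i; exact mul_inv_cancel₀ (hd i).ne'
  have hgi : g⁻¹.val * (g⁻¹.val)ᵀ = U * diagonal (fun i => (d i)⁻¹) * Uᵀ := by
    have e1 : (g⁻¹.val * (g⁻¹.val)ᵀ) * ((g.val)ᵀ * g.val) = 1 := by
      rw [Matrix.mul_assoc, ← Matrix.mul_assoc (g⁻¹.val)ᵀ, ← transpose_mul, ← Units.val_mul,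
        mul_inv_cancel, Units.val_one, transpose_one, Matrix.one_mul, ← Units.val_mul,
        inv_mul_cancel, Units.val_one]
    have e2 : ((g.val)ᵀ * g.val) * (U * diagonal (fun i => (d i)⁻¹) * Uᵀ) = 1 := by
      rw [hg]
      calc U * diagonal d * Uᵀ * (U * diagonal (fun i => (d i)⁻¹) * Uᵀ)
          = U * diagonal d * (Uᵀ * U) * diagonal (fun i => (d i)⁻¹) * Uᵀ := by
            simp only [Matrix.mul_assoc]
        _ = U * (diagonal d * diagonal (fun i => (d i)⁻¹)) * Uᵀ := by
            rw [h1, Matrix.mul_one]; simp only [Matrix.mul_assoc]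
        _ = 1 := by rw [hdd, Matrix.mul_one, h2]
    exact left_inv_eq_right_inv e1 e2
  have key : sqFrobNormR (g.val * A * g⁻¹.val) =
      ((diagonal d * (Uᵀ * A * U)) * (diagonal (fun i => (d i)⁻¹) * (Uᵀ * A * U)ᵀ)).trace := by
    rw [sqFrobNormR_eq_trace]
    calc (g.val * A * g⁻¹.val * (g.val * A * g⁻¹.val)ᵀ).trace
        = (g.val * (A * (g⁻¹.val * (g⁻¹.val)ᵀ) * Aᵀ * (g.val)ᵀ)).trace := by
          simp only [transpose_mul, Matrix.mul_assoc]
      _ = (A * (g⁻¹.val * (g⁻¹.val)ᵀ) * Aᵀ * ((g.val)ᵀ * g.val)).trace := by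
          rw [trace_mul_comm]; simp only [Matrix.mul_assoc]
      _ = ((A * U * diagonal (fun i => (d i)⁻¹) * Uᵀ * Aᵀ * U) * (diagonal d * Uᵀ)).trace := by
          rw [hgi, hg]; simp only [Matrix.mul_assoc]
      _ = _ := by
          rw [trace_mul_comm]
          simp only [transpose_mul, transpose_transpose, Matrix.mul_assoc]
  rw [key, trace]
  refine Finset.sum_congr rfl fun i _ => ?_
  rw [diag_apply, mul_apply]
  refine Finset.sum_congr rfl fun j _ => ?_
  rw [diagonal_mul, diagonal_mul, transpose_apply]
  ring

theorem sum_sq_mul_sub (B : ι → Matrix (Fin n) (Fin n) ℝ) (x : Fin n → ℝ) :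
    ∑ k, ∑ i, ∑ j, B k i j ^ 2 * (x i - x j) =
      ∑ i, x i * (∑ k, (B k * (B k)ᵀ - (B k)ᵀ * B k)) i i := by
  simp only [Matrix.sum_apply, Finset.mul_sum]
  conv_rhs => rw [Finset.sum_comm]
  refine Finset.sum_congr rfl fun k _ => ?_
  simp only [Matrix.sub_apply, mul_apply, transpose_apply, mul_sub, Finset.sum_sub_distrib,
    Finset.mul_sum]
  congr 1
  · exact Finset.sum_congr rfl fun i _ => Finset.sum_congr rfl fun j _ => by ring
  · rw [Finset.sum_comm]
    exact Finset.sum_congr rfl fun i _ => Finset.sum_congr rfl fun j _ => by ring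

theorem sum_moment_conj {U : Matrix (Fin n) (Fin n) ℝ} (h2 : U * Uᵀ = 1)
    (A : ι → Matrix (Fin n) (Fin n) ℝ) :
    ∑ k, ((Uᵀ * A k * U) * (Uᵀ * A k * U)ᵀ - (Uᵀ * A k * U)ᵀ * (Uᵀ * A k * U)) =
      Uᵀ * (∑ k, (A k * (A k)ᵀ - (A k)ᵀ * A k)) * U := by
  rw [Finset.mul_sum, Finset.sum_mul]
  refine Finset.sum_congr rfl fun k _ => ?_
  have h (X Y : Matrix (Fin n) (Fin n) ℝ) :
      (Uᵀ * X * U) * (Uᵀ * Y * U) = Uᵀ * (X * Y) * U := by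
    calc (Uᵀ * X * U) * (Uᵀ * Y * U) = Uᵀ * X * (U * Uᵀ) * Y * U := by
          simp only [Matrix.mul_assoc]
      _ = _ := by rw [h2, Matrix.mul_one]; simp only [Matrix.mul_assoc]
  have ht : (Uᵀ * A k * U)ᵀ = Uᵀ * (A k)ᵀ * U := by
    simp only [transpose_mul, transpose_transpose, Matrix.mul_assoc]
  rw [ht, h, h, Matrix.mul_sub, Matrix.sub_mul]

theorem sqFrobNormR_orthogonal_conj {U : Matrix (Fin n) (Fin n) ℝ} (h2 : U * Uᵀ = 1)
    (A : Matrix (Fin n) (Fin n) ℝ) :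
    ∑ i, ∑ j, (Uᵀ * A * U) i j ^ 2 = sqFrobNormR A := by
  have h : ∑ i, ∑ j, (Uᵀ * A * U) i j ^ 2 = sqFrobNormR (Uᵀ * A * U) := by
    simp [sqFrobNormR]
  rw [h, sqFrobNormR_eq_trace, sqFrobNormR_eq_trace]
  calc ((Uᵀ * A * U) * (Uᵀ * A * U)ᵀ).trace = (Uᵀ * (A * (U * Uᵀ) * Aᵀ * U)).trace := by
        simp only [transpose_mul, transpose_transpose, Matrix.mul_assoc]
    _ = (A * Aᵀ * (U * Uᵀ)).trace := by
        rw [trace_mul_comm, h2, Matrix.mul_one, Matrix.mul_assoc, Matrix.mul_assoc,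
          Matrix.mul_assoc, h2]
    _ = (A * Aᵀ).trace := by rw [h2, Matrix.mul_one]

theorem sum_sqFrobNormR_conj_sub {A : ι → Matrix (Fin n) (Fin n) ℝ}
    (hA : ∑ k, (A k * (A k)ᵀ - (A k)ᵀ * A k) = 0) {g : (Matrix (Fin n) (Fin n) ℝ)ˣ}
    {U : Matrix (Fin n) (Fin n) ℝ} {d : Fin n → ℝ} (hd : ∀ i, 0 < d i)
    (h1 : Uᵀ * U = 1) (h2 : U * Uᵀ = 1) (hg : (g.val)ᵀ * g.val = U * diagonal d * Uᵀ) :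
    ∑ k, sqFrobNormR (g.val * A k * g⁻¹.val) - ∑ k, sqFrobNormR (A k) =
      ∑ k, ∑ i, ∑ j, (Uᵀ * A k * U) i j ^ 2 * (d i / d j - 1 - Real.log (d i / d j)) := by
  have hz := sum_sq_mul_sub (fun k => Uᵀ * A k * U) (fun i => Real.log (d i))
  rw [sum_moment_conj h2, hA] at hz
  simp only [mul_zero, Matrix.zero_mul, Matrix.zero_apply, Finset.sum_const_zero] at hz
  rw [← sub_zero (_ - _), ← hz]
  simp only [sqFrobNormR_conj hd h1 h2 hg, ← sqFrobNormR_orthogonal_conj h2 (A _),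
    ← Finset.sum_sub_distrib]
  refine Finset.sum_congr rfl fun k _ => Finset.sum_congr rfl fun i _ =>
    Finset.sum_congr rfl fun j _ => ?_
  rw [Real.log_div (hd i).ne' (hd j).ne']
  ring

theorem sub_one_sub_log_nonneg {x : ℝ} (hx : 0 < x) : 0 ≤ x - 1 - Real.log x := by
  linarith [Real.log_le_sub_one_of_pos hx]

/-- A tuple with vanishing moment map minimizes the norm in its conjugation orbit. -/
theorem sum_sqFrobNormR_le_conj {A : ι → Matrix (Fin n) (Fin n) ℝ}
    (hA : ∑ k, (A k * (A k)ᵀ - (A k)ᵀ * A k) = 0) (g : (Matrix (Fin n) (Fin n) ℝ)ˣ) :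
    ∑ k, sqFrobNormR (A k) ≤ ∑ k, sqFrobNormR (g.val * A k * g⁻¹.val) := by
  obtain ⟨U, d, hd, h1, h2, hg⟩ := exists_diagonalization_transpose_mul_self g
  rw [← sub_nonneg, sum_sqFrobNormR_conj_sub hA hd h1 h2 hg]
  exact Finset.sum_nonneg fun k _ => Finset.sum_nonneg fun i _ => Finset.sum_nonneg fun j _ =>
    mul_nonneg (sq_nonneg _) (sub_one_sub_log_nonneg (div_pos (hd i) (hd j)))

/-- If `g` preserves the norm of a tuple with vanishing moment map, then `gᵀ g` stabilizes it. -/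
theorem commute_of_sum_sqFrobNormR_conj_eq {A : ι → Matrix (Fin n) (Fin n) ℝ}
    (hA : ∑ k, (A k * (A k)ᵀ - (A k)ᵀ * A k) = 0) (g : (Matrix (Fin n) (Fin n) ℝ)ˣ)
    (heq : ∑ k, sqFrobNormR (g.val * A k * g⁻¹.val) = ∑ k, sqFrobNormR (A k)) (k : ι) :
    Commute ((g.val)ᵀ * g.val) (A k) := by
  obtain ⟨U, d, hd, h1, h2, hg⟩ := exists_diagonalization_transpose_mul_self g
  have hs := sum_sqFrobNormR_conj_sub hA hd h1 h2 hg
  rw [heq, sub_self] at hs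
  have hnn (k i j) : 0 ≤ (Uᵀ * A k * U) i j ^ 2 * (d i / d j - 1 - Real.log (d i / d j)) :=
    mul_nonneg (sq_nonneg _) (sub_one_sub_log_nonneg (div_pos (hd i) (hd j)))
  have hz (i j) : (Uᵀ * A k * U) i j = 0 ∨ d i = d j := by
    have e1 := (Finset.sum_eq_zero_iff_of_nonneg fun k _ => Finset.sum_nonneg fun i _ =>
      Finset.sum_nonneg fun j _ => hnn k i j).1 hs.symm k (Finset.mem_univ _)
    have e2 := (Finset.sum_eq_zero_iff_of_nonneg fun i _ =>
      Finset.sum_nonneg fun j _ => hnn k i j).1 e1 i (Finset.mem_univ _)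
    have e3 := (Finset.sum_eq_zero_iff_of_nonneg fun j _ => hnn k i j).1 e2 j (Finset.mem_univ _)
    rcases mul_eq_zero.1 e3 with h | h
    · exact .inl (pow_eq_zero_iff two_ne_zero |>.1 h)
    · right
      by_contra hne
      have := Real.log_lt_sub_one_of_pos (div_pos (hd i) (hd j))
        (fun h => hne ((div_eq_one_iff_eq (hd j).ne').1 h))
      linarith
  have hc : diagonal d * (Uᵀ * A k * U) = (Uᵀ * A k * U) * diagonal d := by
    ext i j
    rw [diagonal_mul, mul_diagonal]
    rcases hz i j with h | h
    · rw [h]; ring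
    · rw [h]; ring
  rw [hg]
  calc U * diagonal d * Uᵀ * A k = U * diagonal d * Uᵀ * A k * (U * Uᵀ) := by
        rw [h2, Matrix.mul_one]
    _ = U * (diagonal d * (Uᵀ * A k * U)) * Uᵀ := by simp only [Matrix.mul_assoc]
    _ = (U * Uᵀ) * A k * (U * diagonal d * Uᵀ) := by rw [hc]; simp only [Matrix.mul_assoc]
    _ = A k * (U * diagonal d * Uᵀ) := by rw [h2, Matrix.one_mul]

/-- The moment map vanishes on tuples of minimal norm in their conjugation orbit. -/
theorem moment_eq_zero_of_minimal {A : ι → Matrix (Fin n) (Fin n) ℝ}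
    (hmin : ∀ g : (Matrix (Fin n) (Fin n) ℝ)ˣ,
      ∑ k, sqFrobNormR (A k) ≤ ∑ k, sqFrobNormR (g.val * A k * g⁻¹.val)) :
    ∑ k, (A k * (A k)ᵀ - (A k)ᵀ * A k) = 0 := by
  obtain ⟨U, m, h1, h2, hM⟩ := exists_orthogonal_diagonalization
    (S := ∑ k, (A k * (A k)ᵀ - (A k)ᵀ * A k)) (by simp [transpose_sum])
  set f : ℝ → ℝ := fun t =>
    ∑ k, ∑ i, ∑ j, (Uᵀ * A k * U) i j ^ 2 * Real.exp (t * (m i - m j)) with hf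
  have hval (t : ℝ) : ∃ g : (Matrix (Fin n) (Fin n) ℝ)ˣ,
      ∑ k, sqFrobNormR (g.val * A k * g⁻¹.val) = f t := by
    have hee (s : ℝ) : diagonal (fun i => Real.exp (s * m i)) *
        diagonal (fun i => Real.exp (-s * m i)) = 1 := by
      rw [diagonal_mul_diagonal, ← diagonal_one]
      congr 1; ext i
      rw [← Real.exp_add, show s * m i + -s * m i = 0 by ring, Real.exp_zero]
    have hmul (s : ℝ) : (diagonal (fun i => Real.exp (s * m i)) * Uᵀ) *
        (U * diagonal (fun i => Real.exp (-s * m i))) = 1 := by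
      calc _ = diagonal (fun i => Real.exp (s * m i)) * (Uᵀ * U) *
          diagonal (fun i => Real.exp (-s * m i)) := by simp only [Matrix.mul_assoc]
        _ = 1 := by rw [h1, Matrix.mul_one, hee]
    refine ⟨⟨_, _, hmul (t / 2), mul_eq_one_comm.1 (hmul (t / 2))⟩, ?_⟩
    have hg : (diagonal (fun i => Real.exp (t / 2 * m i)) * Uᵀ)ᵀ *
        (diagonal (fun i => Real.exp (t / 2 * m i)) * Uᵀ) =
        U * diagonal (fun i => Real.exp (t * m i)) * Uᵀ := by
      have hsq : diagonal (fun i => Real.exp (t * m i)) =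
          diagonal (fun i => Real.exp (t / 2 * m i)) *
            diagonal (fun i => Real.exp (t / 2 * m i)) := by
        rw [diagonal_mul_diagonal]
        congr 1; ext i
        rw [← Real.exp_add]; congr 1; ring
      rw [hsq, transpose_mul, transpose_transpose, diagonal_transpose]
      simp only [Matrix.mul_assoc]
    refine Finset.sum_congr rfl fun k _ => ?_
    rw [sqFrobNormR_conj (fun i => Real.exp_pos _) h1 h2 hg]
    refine Finset.sum_congr rfl fun i _ => Finset.sum_congr rfl fun j _ => ?_
    rw [← Real.exp_sub, mul_sub]
  have hf0 : f 0 = ∑ k, sqFrobNormR (A k) := by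
    simp [hf, sqFrobNormR_orthogonal_conj h2]
  have hlm : IsLocalMin f 0 := Filter.Eventually.of_forall fun t => by
    obtain ⟨g, hg⟩ := hval t
    rw [hf0, ← hg]
    exact hmin g
  have hder : HasDerivAt f (∑ k, ∑ i, ∑ j, (Uᵀ * A k * U) i j ^ 2 * (m i - m j)) 0 := by
    refine HasDerivAt.fun_sum fun k _ => HasDerivAt.fun_sum fun i _ =>
      HasDerivAt.fun_sum fun j _ => HasDerivAt.const_mul _ ?_
    simpa using ((hasDerivAt_id (0 : ℝ)).mul_const (m i - m j)).exp
  have hzero := hlm.hasDerivAt_eq_zero hder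
  rw [sum_sq_mul_sub, sum_moment_conj h2, hM] at hzero
  have hUM : Uᵀ * (U * diagonal m * Uᵀ) * U = diagonal m := by
    calc _ = (Uᵀ * U) * diagonal m * (Uᵀ * U) := by simp only [Matrix.mul_assoc]
      _ = diagonal m := by rw [h1, Matrix.one_mul, Matrix.mul_one]
  rw [hUM] at hzero
  simp only [diagonal_apply_eq] at hzero
  have hm : m = 0 := by
    ext i
    exact mul_self_eq_zero.1 ((Finset.sum_eq_zero_iff_of_nonneg
      fun i _ => mul_self_nonneg (m i)).1 hzero i (Finset.mem_univ _))
  rw [hM, hm]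
  simp

/-- For a projection `E`, restricting to the range of `E` and extending by the identity on its
kernel is multiplicative on the commutant of `E`. -/
theorem compress_mul {E X Y : Matrix (Fin n) (Fin n) ℝ} (hE : E * E = E) (hY : Commute E Y) :
    (X * E + (1 - E)) * (Y * E + (1 - E)) = X * Y * E + (1 - E) := by
  have h1 : X * E * (Y * E) = X * Y * E := by
    rw [Matrix.mul_assoc, ← Matrix.mul_assoc E, hY.eq, Matrix.mul_assoc, hE, Matrix.mul_assoc]
  have h2 : X * E * (1 - E) = 0 := by
    rw [Matrix.mul_assoc, mul_sub, mul_one, hE, sub_self, mul_zero]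
  have h3 : (1 - E) * (Y * E) = 0 := by
    rw [← hY.eq, ← Matrix.mul_assoc, sub_mul, one_mul, hE, sub_self, zero_mul]
  have h4 : (1 - E) * (1 - E) = 1 - E := by
    rw [mul_sub, sub_mul, sub_mul]; simp [hE]
  rw [add_mul, mul_add, mul_add, h1, h2, h3, h4, add_zero, zero_add]

/-- If `cᵀ c` commutes with `a`, `b` and `c = ⁅a, b⁆`, then `c` is orthogonal. -/
theorem transpose_mul_self_commutator_eq_one {a b : (Matrix (Fin n) (Fin n) ℝ)ˣ}
    (ha : Commute ((⁅a, b⁆.val)ᵀ * ⁅a, b⁆.val) a.val)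
    (hb : Commute ((⁅a, b⁆.val)ᵀ * ⁅a, b⁆.val) b.val) :
    (⁅a, b⁆.val)ᵀ * ⁅a, b⁆.val = 1 := by
  obtain ⟨U, d, hd, h1, h2, hQ⟩ := exists_diagonalization_transpose_mul_self ⁅a, b⁆
  rw [hQ] at ha hb ⊢
  suffices hd1 : ∀ i, d i = 1 by
    rw [funext hd1, diagonal_one, Matrix.mul_one, h2]
  intro i₀
  set e : Fin n → ℝ := fun i => if d i = d i₀ then 1 else 0 with he
  set E := U * diagonal e * Uᵀ with hE
  have hconj (x y : Fin n → ℝ) :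
      (U * diagonal x * Uᵀ) * (U * diagonal y * Uᵀ) = U * diagonal (x * y) * Uᵀ := by
    calc _ = U * diagonal x * (Uᵀ * U) * diagonal y * Uᵀ := by simp only [Matrix.mul_assoc]
      _ = U * (diagonal x * diagonal y) * Uᵀ := by
        rw [h1, Matrix.mul_one]; simp only [Matrix.mul_assoc]
      _ = _ := by rw [diagonal_mul_diagonal]; rfl
  have hEE : E * E = E := by
    rw [hE, hconj]
    congr 3; ext i
    simp [he]
  have hEt : Eᵀ = E := by
    simp only [hE, transpose_mul, transpose_transpose, diagonal_transpose, Matrix.mul_assoc]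
  clear_value E
  have hcomm {M : Matrix (Fin n) (Fin n) ℝ} (hM : Commute (U * diagonal d * Uᵀ) M) :
      Commute E M := by
    have hdM : diagonal d * (Uᵀ * M * U) = (Uᵀ * M * U) * diagonal d := by
      calc diagonal d * (Uᵀ * M * U) = (Uᵀ * U) * diagonal d * (Uᵀ * M * U) := by
            rw [h1, Matrix.one_mul]
        _ = Uᵀ * ((U * diagonal d * Uᵀ) * M) * U := by simp only [Matrix.mul_assoc]
        _ = (Uᵀ * M * U) * diagonal d * (Uᵀ * U) := by
            rw [hM.eq]; simp only [Matrix.mul_assoc]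
        _ = _ := by rw [h1, Matrix.mul_one]
    have heM : diagonal e * (Uᵀ * M * U) = (Uᵀ * M * U) * diagonal e := by
      ext i j
      have := congrFun (congrFun hdM i) j
      rw [diagonal_mul, mul_diagonal] at this ⊢
      by_cases hij : d i = d j
      · simp only [he, hij]; ring
      · have h0 : (Uᵀ * M * U) i j = 0 := by
          have : (d i - d j) * (Uᵀ * M * U) i j = 0 := by linarith
          exact (mul_eq_zero.1 this).resolve_left (sub_ne_zero.2 hij)
        rw [h0]; ring
    calc E * M = U * diagonal e * Uᵀ * M * (U * Uᵀ) := by rw [hE, h2, Matrix.mul_one]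
      _ = U * (diagonal e * (Uᵀ * M * U)) * Uᵀ := by simp only [Matrix.mul_assoc]
      _ = (U * Uᵀ) * M * (U * diagonal e * Uᵀ) := by rw [heM]; simp only [Matrix.mul_assoc]
      _ = M * E := by rw [hE, h2, Matrix.one_mul]
  have hEa := hcomm ha
  have hEb := hcomm hb
  have hEai : Commute E a⁻¹.val := hEa.units_inv_right
  have hEbi : Commute E b⁻¹.val := hEb.units_inv_right
  have hcval : ⁅a, b⁆.val = a.val * b.val * a⁻¹.val * b⁻¹.val := by
    rw [commutatorElement_def]; rfl
  have hEc : Commute E ⁅a, b⁆.val := by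
    rw [hcval]; exact ((hEa.mul_right hEb).mul_right hEai).mul_right hEbi
  have hdet : (⁅a, b⁆.val * E + (1 - E)).det = 1 := by
    have hone (u : (Matrix (Fin n) (Fin n) ℝ)ˣ) (hu : Commute E u⁻¹.val) :
        (u.val * E + (1 - E)).det * (u⁻¹.val * E + (1 - E)).det = 1 := by
      rw [← det_mul, compress_mul hEE hu, ← Units.val_mul, mul_inv_cancel, Units.val_one,
        one_mul, add_sub_cancel, det_one]
    rw [hcval, ← compress_mul hEE hEbi, ← compress_mul hEE hEai, ← compress_mul hEE hEb,
      det_mul, det_mul, det_mul]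
    calc _ = ((a.val * E + (1 - E)).det * (a⁻¹.val * E + (1 - E)).det) *
        ((b.val * E + (1 - E)).det * (b⁻¹.val * E + (1 - E)).det) := by ring
      _ = 1 := by rw [hone a hEai, hone b hEbi, one_mul]
  have hQdet : (((⁅a, b⁆.val)ᵀ * ⁅a, b⁆.val) * E + (1 - E)).det = 1 := by
    rw [← compress_mul hEE hEc, det_mul, hdet, mul_one, ← hdet, ← det_transpose (_ * E + _)]
    congr 1
    have hEct : Commute E (⁅a, b⁆.val)ᵀ := by
      have := congrArg transpose hEc.eq
      rw [transpose_mul, transpose_mul, hEt] at this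
      exact this.symm
    rw [transpose_add, transpose_mul, transpose_sub, transpose_one, hEt,
      transpose_transpose, hEc.eq]
  have hprod : ∏ i, (if d i = d i₀ then d i₀ else 1) = 1 := by
    have hD : (U * diagonal d * Uᵀ) * E + (1 - E) =
        U * diagonal (fun i => if d i = d i₀ then d i₀ else 1) * Uᵀ := by
      rw [← h2, hE, hconj, ← add_sub_assoc]
      have : U * Uᵀ = U * diagonal 1 * Uᵀ := by
        rw [show diagonal (1 : Fin n → ℝ) = 1 from diagonal_one, Matrix.mul_one]
      rw [this, ← Matrix.add_mul, ← Matrix.mul_add, ← Matrix.sub_mul, ← Matrix.mul_sub,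
        diagonal_add, diagonal_sub]
      congr 3; ext i
      by_cases h : d i = d i₀ <;> simp [he, h]
    rw [hQ, hD, det_mul, det_mul, mul_right_comm, ← det_mul, h2, det_one, one_mul,
      det_diagonal] at hQdet
    exact hQdet
  rw [Finset.prod_ite, Finset.prod_const_one, mul_one, Finset.prod_const] at hprod
  refine (pow_eq_one_iff_of_nonneg (hd i₀).le ?_).1 hprod
  exact (Finset.card_pos.2 ⟨i₀, by simp⟩).ne'

theorem sqFrobNormR_mul_of_orthogonal {Q : Matrix (Fin n) (Fin n) ℝ} (hQ : Qᵀ * Q = 1)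
    (A : Matrix (Fin n) (Fin n) ℝ) : sqFrobNormR (Q * A) = sqFrobNormR A := by
  rw [sqFrobNormR_eq_trace', sqFrobNormR_eq_trace', transpose_mul, Matrix.mul_assoc,
    ← Matrix.mul_assoc Qᵀ, hQ, Matrix.one_mul]

/-- Along the upper central series, `ρ(h)ᵀ ρ(h)` lies in the commutant of a representation
whose moment map vanishes. -/
theorem commute_transpose_mul_self_of_mem_upperCentralSeries {Γ : Type*} [Group Γ]
    {c : ι → Γ} (hc : Subgroup.closure (Set.range c) = ⊤)
    {ρ : Γ →* (Matrix (Fin n) (Fin n) ℝ)ˣ}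
    (hρ : ∑ k, ((ρ (c k)).val * (ρ (c k)).valᵀ - (ρ (c k)).valᵀ * (ρ (c k)).val) = 0)
    (m : ℕ) {h : Γ} (hh : h ∈ Subgroup.upperCentralSeries Γ m) (γ : Γ) :
    Commute ((ρ h).valᵀ * (ρ h).val) (ρ γ).val := by
  induction m generalizing h γ with
  | zero =>
    rw [Subgroup.upperCentralSeries_zero, Subgroup.mem_bot] at hh
    simp [hh]
  | succ m ih =>
    have hgen (k : ι) : Commute ((ρ h).valᵀ * (ρ h).val) (ρ (c k)).val := by
      refine commute_of_sum_sqFrobNormR_conj_eq hρ (ρ h) (Finset.sum_congr rfl fun k _ => ?_) k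
      have hmem := Subgroup.mem_upperCentralSeries_succ_iff.1 hh (c k)
      have horth := transpose_mul_self_commutator_eq_one (a := ρ h) (b := ρ (c k))
        (by rw [← map_commutatorElement]; exact ih hmem h)
        (by rw [← map_commutatorElement]; exact ih hmem (c k))
      have hcomm : (ρ h).val * (ρ (c k)).val * (ρ h)⁻¹.val =
          ⁅ρ h, ρ (c k)⁆.val * (ρ (c k)).val := by
        rw [← Units.val_mul, ← Units.val_mul, ← Units.val_mul, commutatorElement_def,
          inv_mul_cancel_right]
      rw [hcomm, sqFrobNormR_mul_of_orthogonal horth]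
    have hγ : γ ∈ Subgroup.closure (Set.range c) := hc ▸ Subgroup.mem_top γ
    induction hγ using Subgroup.closure_induction with
    | mem x hx => obtain ⟨k, rfl⟩ := hx; exact hgen k
    | one => simp
    | mul x y _ _ hx hy => rw [map_mul, Units.val_mul]; exact hx.mul_right hy
    | inv x _ hx => rw [map_inv]; exact hx.units_inv_right

end KempfNess

/-- The real form of Theorem III of the paper, for `G(ℝ) = GL_n ℝ`: a representation `ρ` of
a finitely generated nilpotent group `Γ` in `GL_n ℝ` lies in the real Kempf–Ness set (its
tuple of generator images has minimal Frobenius norm within its `GL_n ℝ`-conjugation orbit)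
if and only if every `ρ(γ)` commutes with its transpose. -/
theorem theoremIII_GL_real (Γ : Type) [Group Γ] [Group.IsNilpotent Γ]
    (r n : ℕ) (hn : 1 ≤ n) (c : Fin r → Γ) (hc : Subgroup.closure (Set.range c) = ⊤)
    (ρ : Γ →* (Matrix (Fin n) (Fin n) ℝ)ˣ) :
    (∀ g : (Matrix (Fin n) (Fin n) ℝ)ˣ,
        ∑ i, sqFrobNormR ((g : Matrix (Fin n) (Fin n) ℝ) * (ρ (c i) : Matrix (Fin n) (Fin n) ℝ) *
            ((g⁻¹ : (Matrix (Fin n) (Fin n) ℝ)ˣ) : Matrix (Fin n) (Fin n) ℝ)) ≥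
          ∑ i, sqFrobNormR (ρ (c i) : Matrix (Fin n) (Fin n) ℝ)) ↔
      (∀ γ : Γ, (ρ γ : Matrix (Fin n) (Fin n) ℝ) * (ρ γ : Matrix (Fin n) (Fin n) ℝ)ᵀ =
          (ρ γ : Matrix (Fin n) (Fin n) ℝ)ᵀ * (ρ γ : Matrix (Fin n) (Fin n) ℝ)) := by
  constructor
  · intro hmin γ
    have hρ := KempfNess.moment_eq_zero_of_minimal hmin
    obtain ⟨m, hm⟩ := Group.IsNilpotent.nilpotent' (G := Γ)
    have hcomm := KempfNess.commute_transpose_mul_self_of_mem_upperCentralSeries hc hρ m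
      (hm ▸ Subgroup.mem_top γ) γ
    refine (ρ γ).isUnit.mul_right_cancel ?_
    rw [Matrix.mul_assoc]
    exact hcomm.eq.symm
  · intro hnormal g
    exact KempfNess.sum_sqFrobNormR_le_conj
      (Finset.sum_eq_zero fun k _ => sub_eq_zero.2 (hnormal (c k))) g
end

section
/- Let m be an n×n complex matrix and let λ₁, …, λ_n be the roots, counted with multiplicity, of its characteristic polynomial (their multiset has cardinality n since ℂ is algebraically closed). Then ∑_{j=1}^n |λ_j|² ≤ ‖m‖², where ‖·‖ is the Frobenius norm. Moreover, equality holds if and only if m is normal. -/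
open Matrix

theorem ofReal_sum_sum_norm_sq {m n : Type*} [Fintype m] [Fintype n] (A : Matrix m n ℂ) :
    ((∑ i, ∑ j, ‖A i j‖ ^ 2 : ℝ) : ℂ) = (Aᴴ * A).trace := by
  simp only [trace, diag_apply, mul_apply, conjTranspose_apply]
  rw [Finset.sum_comm]
  push_cast
  simp [Complex.conj_mul']

/-- Every complex square matrix of positive size is unitarily similar to a block upper triangular
matrix with a one-dimensional leading block. -/
theorem exists_unitary_block_triangular {n : ℕ} (A : Matrix (Fin (n + 1)) (Fin (n + 1)) ℂ) :
    ∃ (U : Matrix (Fin (n + 1)) (Unit ⊕ Fin n) ℂ) (a : ℂ) (r : Matrix Unit (Fin n) ℂ)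
      (B : Matrix (Fin n) (Fin n) ℂ), Uᴴ * U = 1 ∧ U * Uᴴ = 1 ∧
        A = U * fromBlocks (diagonal fun _ => a) r 0 B * Uᴴ := by
  obtain ⟨a, ha⟩ := Module.End.exists_eigenvalue (toEuclideanLin A)
  obtain ⟨v, hv⟩ := ha.exists_hasEigenvector
  let w : EuclideanSpace ℂ (Fin (n + 1)) := ((‖v‖⁻¹ : ℝ) : ℂ) • v
  have hw : ‖w‖ = 1 := by
    simp [w, norm_smul, hv.2]
  have hAw : toEuclideanLin A w = a • w := by
    simp only [w, map_smul, hv.apply_eq_smul]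
    rw [smul_comm]
  obtain ⟨b, hb⟩ := Orthonormal.exists_orthonormalBasis_extension_of_card_eq (𝕜 := ℂ)
    (ι := Unit ⊕ Fin n) (v := fun _ => w) (s := {Sum.inl ()})
    (by simp [add_comm]) (by
      refine ⟨fun i => hw, fun i j hij => ?_⟩
      exact absurd (Subsingleton.elim i j) hij)
  let U : Matrix (Fin (n + 1)) (Unit ⊕ Fin n) ℂ := of fun i k => b k i
  have hU : Uᴴ * U = 1 := by
    ext k l
    have := (orthonormal_iff_ite.mp b.orthonormal) k l
    rw [one_apply, ← this]
    simp [U, mul_apply, PiLp.inner_apply, mul_comm]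
  have hU' : U * Uᴴ = 1 := (mul_eq_one_comm_of_card_eq _ _ _ (by simp [add_comm])).mp hU
  have hcol (i) : (A * U) i (Sum.inl ()) = a * U i (Sum.inl ()) := by
    have hi := congrArg (fun x : EuclideanSpace ℂ (Fin (n + 1)) => x i) hAw
    have hbw : b (Sum.inl ()) = w := hb _ rfl
    simpa [U, hbw, mul_apply, toLpLin_apply, mulVec, dotProduct] using hi
  have hblock (k : Unit ⊕ Fin n) : (Uᴴ * (A * U)) k (Sum.inl ()) =
      a * (1 : Matrix (Unit ⊕ Fin n) (Unit ⊕ Fin n) ℂ) k (Sum.inl ()) := by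
    rw [← hU, mul_apply, mul_apply, Finset.mul_sum]
    refine Finset.sum_congr rfl fun i _ => ?_
    rw [hcol]
    ring
  refine ⟨U, a, (Uᴴ * (A * U)).toBlocks₁₂, (Uᴴ * (A * U)).toBlocks₂₂, hU, hU', ?_⟩
  have hM : fromBlocks (diagonal fun _ => a) (Uᴴ * (A * U)).toBlocks₁₂ 0
      (Uᴴ * (A * U)).toBlocks₂₂ = Uᴴ * (A * U) := by
    conv_rhs => rw [← fromBlocks_toBlocks (Uᴴ * (A * U))]
    rw [fromBlocks_inj]
    refine ⟨?_, rfl, ?_, rfl⟩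
    · ext ⟨⟩ ⟨⟩
      simp [toBlocks₁₁, hblock]
    · ext i ⟨⟩
      simp [toBlocks₂₁, hblock]
  rw [hM]
  calc A = (U * Uᴴ) * A * (U * Uᴴ) := by simp [hU']
    _ = U * (Uᴴ * (A * U)) * Uᴴ := by simp only [Matrix.mul_assoc]

section UnitarySimilarity

variable {m n : Type*} [Fintype m] [Fintype n] [DecidableEq n]
  {U : Matrix m n ℂ} (T : Matrix n n ℂ)

theorem charpoly_unitary_conj [DecidableEq m] (hU : Uᴴ * U = 1) (hcard : Fintype.card m = Fintype.card n) :
    (U * T * Uᴴ).charpoly = T.charpoly := by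
  rw [Matrix.mul_assoc, charpoly_mul_comm_of_le _ _ hcard.ge, Matrix.mul_assoc, hU]
  simp [hcard]

theorem sum_sum_norm_sq_unitary_conj (hU : Uᴴ * U = 1) :
    ∑ i, ∑ j, ‖(U * T * Uᴴ) i j‖ ^ 2 = ∑ i, ∑ j, ‖T i j‖ ^ 2 := by
  apply Complex.ofReal_injective
  rw [ofReal_sum_sum_norm_sq, ofReal_sum_sum_norm_sq]
  calc ((U * T * Uᴴ)ᴴ * (U * T * Uᴴ)).trace = (U * (Tᴴ * (Uᴴ * U) * T * Uᴴ)).trace := by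
        simp only [conjTranspose_mul, conjTranspose_conjTranspose, Matrix.mul_assoc]
    _ = (Tᴴ * T).trace := by
        rw [trace_mul_comm, hU, Matrix.mul_one, Matrix.mul_assoc, hU, Matrix.mul_one]

theorem unitary_conj_normal_iff (hU : Uᴴ * U = 1) :
    (U * T * Uᴴ) * (U * T * Uᴴ)ᴴ = (U * T * Uᴴ)ᴴ * (U * T * Uᴴ) ↔ T * Tᴴ = Tᴴ * T := by
  have hconj (X : Matrix n n ℂ) : Uᴴ * (U * X * Uᴴ) * U = X := by
    calc Uᴴ * (U * X * Uᴴ) * U = (Uᴴ * U) * X * (Uᴴ * U) := by simp only [Matrix.mul_assoc]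
      _ = X := by simp [hU]
  have hmul (X Y : Matrix n n ℂ) : (U * X * Uᴴ) * (U * Y * Uᴴ) = U * (X * Y) * Uᴴ := by
    calc (U * X * Uᴴ) * (U * Y * Uᴴ) = U * X * (Uᴴ * U) * Y * Uᴴ := by
          simp only [Matrix.mul_assoc]
      _ = U * (X * Y) * Uᴴ := by simp [hU, Matrix.mul_assoc]
  have hstar : (U * T * Uᴴ)ᴴ = U * Tᴴ * Uᴴ := by
    simp [conjTranspose_mul, Matrix.mul_assoc]
  rw [hstar, hmul, hmul]
  refine ⟨fun h => ?_, fun h => by rw [h]⟩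
  rw [← hconj (T * Tᴴ), h, hconj]

end UnitarySimilarity

open scoped ComplexOrder in
theorem fromBlocks_diagonal_normal_iff {n : Type*} [Fintype n] (a : ℂ) (r : Matrix Unit n ℂ)
    (B : Matrix n n ℂ) :
    (fromBlocks (diagonal fun _ => a) r 0 B * (fromBlocks (diagonal fun _ => a) r 0 B)ᴴ =
      (fromBlocks (diagonal fun _ => a) r 0 B)ᴴ * fromBlocks (diagonal fun _ => a) r 0 B) ↔
      r = 0 ∧ B * Bᴴ = Bᴴ * B := by
  rw [fromBlocks_conjTranspose, fromBlocks_multiply, fromBlocks_multiply, fromBlocks_inj]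
  constructor
  · rintro ⟨h₁, -, -, h₂⟩
    have hr : r = 0 := by
      rw [← self_mul_conjTranspose_eq_zero]
      simpa [diagonal_conjTranspose, mul_comm] using h₁
    subst hr
    exact ⟨rfl, by simpa using h₂⟩
  · rintro ⟨rfl, h⟩
    simp [diagonal_conjTranspose, mul_comm, h]

/-- Lemma 4.2 of the paper (Schur's inequality with characterization of equality):
for a complex `n × n` matrix `m` with eigenvalues `λ₁, …, λₙ` (the roots of the
characteristic polynomial, with multiplicity), `∑ |λⱼ|² ≤ ‖m‖²` in the Frobenius norm,
with equality if and only if `m` is normal. -/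
theorem schur_inequality (n : ℕ) (m : Matrix (Fin n) (Fin n) ℂ) :
    ((m.charpoly.roots.map fun z => ‖z‖ ^ 2).sum ≤ sqFrobNorm m) ∧
      (((m.charpoly.roots.map fun z => ‖z‖ ^ 2).sum = sqFrobNorm m) ↔
        m * mᴴ = mᴴ * m) := by
  induction n with
  | zero => simp [sqFrobNorm, charpoly_isEmpty]
  | succ n ih =>
    obtain ⟨U, a, r, B, hU, -, rfl⟩ := exists_unitary_block_triangular m
    obtain ⟨hle, heq⟩ := ih B
    have hroots : ((U * fromBlocks (diagonal fun _ => a) r 0 B * Uᴴ).charpoly.roots.map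
        fun z => ‖z‖ ^ 2).sum = ‖a‖ ^ 2 + (B.charpoly.roots.map fun z => ‖z‖ ^ 2).sum := by
      rw [charpoly_unitary_conj _ hU (by simp [add_comm]), charpoly_fromBlocks_zero₂₁,
        charpoly_diagonal, Polynomial.roots_mul (mul_ne_zero
          (by simpa using Polynomial.X_sub_C_ne_zero a) B.charpoly_monic.ne_zero)]
      simp
    have hnorm : sqFrobNorm (U * fromBlocks (diagonal fun _ => a) r 0 B * Uᴴ) =
        ‖a‖ ^ 2 + ∑ j, ‖r () j‖ ^ 2 + sqFrobNorm B := by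
      rw [sqFrobNorm, sum_sum_norm_sq_unitary_conj _ hU]
      simp [sqFrobNorm]
    have hr : 0 ≤ ∑ j, ‖r () j‖ ^ 2 := by positivity
    have hr_eq : ∑ j, ‖r () j‖ ^ 2 = 0 ↔ r = 0 := by
      rw [Finset.sum_eq_zero_iff_of_nonneg fun _ _ => by positivity, ← Matrix.ext_iff]
      simp [Unique.forall_iff]
    rw [hroots, hnorm, unitary_conj_normal_iff _ hU, fromBlocks_diagonal_normal_iff, ← heq, ← hr_eq]
    refine ⟨by linarith, fun h => ⟨by linarith, by linarith⟩, fun h => by linarith [h.1, h.2]⟩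
end

section
/- Fix t ∈ ℝ and n ≥ 1. For a diagonal n×n complex matrix D with all diagonal entries nonzero, let s_t(D) denote the diagonal matrix whose i-th diagonal entry is |D_{ii}|^{−t}·D_{ii}. Let g be an invertible n×n complex matrix and suppose h₁, h₂ are invertible matrices such that D₁ := h₁·g·h₁⁻¹ and D₂ := h₂·g·h₂⁻¹ are both diagonal. Then h₁⁻¹·s_t(D₁)·h₁ = h₂⁻¹·s_t(D₂)·h₂; in other words, the eigenvalue-scaling operator σ_t(g) := h⁻¹·s_t(h·g·h⁻¹)·h on diagonalizable invertible matrices is independent of the choice of diagonalizing matrix h. -/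
open Matrix

/-- Entrywise eigenvalue scaling on diagonal matrices: `s_t(D)` is the diagonal matrix whose
`i`-th diagonal entry is `|D i i| ^ (-t) * D i i`. -/
noncomputable def scaleDiag {n : ℕ} (t : ℝ) (D : Matrix (Fin n) (Fin n) ℂ) :
    Matrix (Fin n) (Fin n) ℂ :=
  Matrix.diagonal fun i => ((‖D i i‖ ^ (-t) : ℝ) : ℂ) * D i i

/-- A matrix intertwining two diagonal matrices also intertwines their images under any entrywise
function. -/
theorem Matrix.mul_diagonal_comp_eq_of_mul_diagonal_eq {m n R : Type*} [Fintype m] [Fintype n]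
    [DecidableEq m] [DecidableEq n] [CommRing R] [IsDomain R] {P : Matrix m n R} {a : n → R}
    {b : m → R} (h : P * diagonal a = diagonal b * P) (f : R → R) :
    P * diagonal (f ∘ a) = diagonal (f ∘ b) * P := by
  ext i j
  have hij := congrFun (congrFun h i) j
  simp only [mul_diagonal, diagonal_mul, Function.comp_apply] at hij ⊢
  rw [mul_comm (b i)] at hij
  rcases eq_or_ne (P i j) 0 with h0 | h0
  · simp [h0]
  · rw [mul_left_cancel₀ h0 hij, mul_comm]

/-- Entrywise scaling of diagonal matrices commutes with every matrix intertwining them. -/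
theorem mul_scaleDiag_eq {n : ℕ} (t : ℝ) {P D E : Matrix (Fin n) (Fin n) ℂ} (hD : D.IsDiag)
    (hE : E.IsDiag) (h : P * D = E * P) : P * scaleDiag t D = scaleDiag t E * P := by
  rw [← hD.diagonal_diag, ← hE.diagonal_diag] at h
  exact mul_diagonal_comp_eq_of_mul_diagonal_eq h fun z => ((‖z‖ ^ (-t) : ℝ) : ℂ) * z

/-- Well-definedness of the eigenvalue-scaling operator `σ_t` (Section 5.1 of the paper):
if `h₁ g h₁⁻¹` and `h₂ g h₂⁻¹` are both diagonal, then
`h₁⁻¹ s_t(h₁ g h₁⁻¹) h₁ = h₂⁻¹ s_t(h₂ g h₂⁻¹) h₂`, i.e. `σ_t(g)` does not depend on the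
choice of diagonalizing matrix. -/
theorem scaling_well_defined (n : ℕ) (hn : 1 ≤ n) (t : ℝ)
    (g h₁ h₂ : (Matrix (Fin n) (Fin n) ℂ)ˣ)
    (hD₁ : ((h₁ * g * h₁⁻¹ : (Matrix (Fin n) (Fin n) ℂ)ˣ) : Matrix (Fin n) (Fin n) ℂ).IsDiag)
    (hD₂ : ((h₂ * g * h₂⁻¹ : (Matrix (Fin n) (Fin n) ℂ)ˣ) : Matrix (Fin n) (Fin n) ℂ).IsDiag) :
    ((h₁⁻¹ : (Matrix (Fin n) (Fin n) ℂ)ˣ) : Matrix (Fin n) (Fin n) ℂ) *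
        scaleDiag t ((h₁ * g * h₁⁻¹ : (Matrix (Fin n) (Fin n) ℂ)ˣ) : Matrix (Fin n) (Fin n) ℂ) *
        (h₁ : Matrix (Fin n) (Fin n) ℂ) =
      ((h₂⁻¹ : (Matrix (Fin n) (Fin n) ℂ)ˣ) : Matrix (Fin n) (Fin n) ℂ) *
        scaleDiag t ((h₂ * g * h₂⁻¹ : (Matrix (Fin n) (Fin n) ℂ)ˣ) : Matrix (Fin n) (Fin n) ℂ) *
        (h₂ : Matrix (Fin n) (Fin n) ℂ) := by
  have key := mul_scaleDiag_eq t (P := ((h₂ * h₁⁻¹ : (Matrix (Fin n) (Fin n) ℂ)ˣ) :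
    Matrix (Fin n) (Fin n) ℂ)) hD₁ hD₂ (by
      rw [← Units.val_mul, ← Units.val_mul]
      congr 1
      group)
  rw [← Units.mul_right_inj h₂, ← mul_assoc, ← mul_assoc, ← mul_assoc, ← mul_assoc,
    Units.mul_inv, one_mul, ← Units.val_mul, key, mul_assoc, ← Units.val_mul,
    inv_mul_cancel_right]
end

section
/- Let Γ be a finitely generated nilpotent group and n ≥ 1. Let 𝓜 ⊆ Hom(Γ, GL_n(ℂ)) be the subspace (topology of pointwise convergence) of homomorphisms ρ such that ρ(γ) is a normal matrix for every γ ∈ Γ, and let A ⊆ 𝓜 be the subspace of homomorphisms whose values are all unitary. Then there is a strong deformation retraction H : 𝓜 × [0,1] → 𝓜 of 𝓜 onto A which is U(n)-equivariant for the pointwise conjugation action of the unitary group U(n). -/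
open Matrix

/-- The Kempf–Ness set `𝓜 ⊆ Hom(Γ, GL_n ℂ)`: homomorphisms `Γ → GL_n ℂ` all of whose
values are normal matrices, topologized as a subspace of the product space
`Γ → Matrix (Fin n) (Fin n) ℂ` (topology of pointwise convergence). -/
abbrev NormalRep (Γ : Type) [Group Γ] (n : ℕ) : Type :=
  {f : Γ → Matrix (Fin n) (Fin n) ℂ //
    (f 1 = 1 ∧ (∀ γ₁ γ₂, f (γ₁ * γ₂) = f γ₁ * f γ₂) ∧ (∀ γ, IsUnit (f γ))) ∧
    ∀ γ, f γ * (f γ)ᴴ = (f γ)ᴴ * f γ}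

section CStarAlgebra

variable {A : Type*} [CStarAlgebra A]

/-- The element `|a|⁻ᵗ a`, where `|a| = (a a⋆)^(1/2)`: for a normal invertible `a` this scales each
spectral value `z` to `|z|⁻ᵗ z`. -/
noncomputable def polarScale (t : ℝ) (a : A) : A :=
  NormedSpace.exp ((-(t / 2)) • CFC.log (a * star a)) * a

lemma polarScale_zero (a : A) : polarScale 0 a = a := by
  simp [polarScale]

lemma polarScale_of_mul_star_self {a : A} (ha : a * star a = 1) (t : ℝ) :
    polarScale t a = a := by
  simp [polarScale, ha]

lemma isUnit_exp_smul_log (t : ℝ) (p : A) : IsUnit (NormedSpace.exp (t • CFC.log p)) :=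
  let _ : NormedAlgebra ℚ A := .restrictScalars ℚ ℂ A
  NormedSpace.isUnit_exp _

lemma isSelfAdjoint_exp_smul_log (t : ℝ) (p : A) :
    IsSelfAdjoint (NormedSpace.exp (t • CFC.log p)) :=
  (IsSelfAdjoint.smul (IsSelfAdjoint.all t) IsSelfAdjoint.log).exp

lemma Commute.exp_smul_log {p b : A} (h : Commute p b) (t : ℝ) :
    Commute (NormedSpace.exp (t • CFC.log p)) b :=
  let _ : NormedAlgebra ℚ A := .restrictScalars ℚ ℂ A
  ((h.cfc_real Real.log).smul_left t).exp_left

lemma IsUnit.polarScale {a : A} (ha : IsUnit a) (t : ℝ) : IsUnit (polarScale t a) :=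
  (isUnit_exp_smul_log _ _).mul ha

lemma isStarNormal_polarScale {a : A} (ha : IsStarNormal a) (t : ℝ) :
    IsStarNormal (polarScale t a) := by
  have h : Commute (a * star a) a := (Commute.refl a).mul_left ha.star_comm_self
  have h' : Commute (a * star a) (star a) := ha.star_comm_self.symm.mul_left (Commute.refl _)
  have hs := isSelfAdjoint_exp_smul_log (-(t / 2)) (a * star a)
  have e := h.exp_smul_log (-(t / 2))
  have e' := h'.exp_smul_log (-(t / 2))
  refine ⟨?_⟩
  rw [_root_.polarScale, star_mul, hs.star_eq]
  exact ((e'.symm.mul_right ha.star_comm_self).mul_left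
    ((Commute.refl _).mul_right e))

section Order

variable [PartialOrder A] [StarOrderedRing A]

lemma IsUnit.isStrictlyPositive_mul_star_self {a : A} (ha : IsUnit a) :
    IsStrictlyPositive (a * star a) :=
  (ha.mul ha.star).isStrictlyPositive (mul_star_self_nonneg a)

lemma CFC.log_mul_of_commute {a b : A} (ha : IsStrictlyPositive a) (hb : IsStrictlyPositive b)
    (h : Commute a b) : CFC.log (a * b) = CFC.log a + CFC.log b := by
  let _ : NormedAlgebra ℚ A := .restrictScalars ℚ ℂ A
  have hc : Commute (CFC.log a) (CFC.log b) :=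
    ((h.cfc_real Real.log).symm.cfc_real Real.log).symm
  rw [← CFC.log_exp (CFC.log a + CFC.log b) (IsSelfAdjoint.log.add IsSelfAdjoint.log),
    NormedSpace.exp_add_of_commute hc, CFC.exp_log a, CFC.exp_log b]

lemma polarScale_mul {a b : A} (ha : IsUnit a) (hb : IsUnit b)
    (h : Commute (b * star b) a) (t : ℝ) :
    polarScale t (a * b) = polarScale t a * polarScale t b := by
  let _ : NormedAlgebra ℚ A := .restrictScalars ℚ ℂ A
  have h' : Commute (b * star b) (star a) := by
    simpa using h.star_star
  have hab : Commute (a * star a) (b * star b) := (h.mul_right h').symm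
  have e : a * b * star (a * b) = a * star a * (b * star b) := by
    rw [star_mul, mul_assoc a b, ← mul_assoc b, h'.eq, mul_assoc]
  have hc : Commute (CFC.log (a * star a)) (CFC.log (b * star b)) :=
    ((hab.cfc_real Real.log).symm.cfc_real Real.log).symm
  rw [polarScale, e, CFC.log_mul_of_commute ha.isStrictlyPositive_mul_star_self
    hb.isStrictlyPositive_mul_star_self hab, smul_add,
    NormedSpace.exp_add_of_commute ((hc.smul_left _).smul_right _), polarScale, polarScale]
  simp only [mul_assoc]
  rw [← mul_assoc _ a b, (h.exp_smul_log _).eq, mul_assoc]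

lemma polarScale_one_mul_star_self {a : A} (ha : IsUnit a) :
    polarScale 1 a * star (polarScale 1 a) = 1 := by
  let _ : NormedAlgebra ℚ A := .restrictScalars ℚ ℂ A
  have hs := isSelfAdjoint_exp_smul_log (-(1 / 2)) (a * star a)
  have e : Commute (NormedSpace.exp ((-(1 / 2) : ℝ) • CFC.log (a * star a))) (a * star a) :=
    (Commute.refl _).exp_smul_log _
  have hp : IsStrictlyPositive (a * star a) := ha.isStrictlyPositive_mul_star_self
  rw [polarScale, star_mul, hs.star_eq]
  rw [mul_assoc, ← mul_assoc a, ← e.eq, ← mul_assoc,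
    ← NormedSpace.exp_add_of_commute (Commute.refl _), ← add_smul]
  nth_rewrite 2 [← CFC.exp_log (a * star a) hp]
  rw [← NormedSpace.exp_add_of_commute]
  · norm_num
  · exact (Commute.refl _).smul_left _

lemma polarScale_unitary_conj {u a : A} (hu : u ∈ unitary A) (ha : IsUnit a) (t : ℝ) :
    polarScale t (u * a * star u) = u * polarScale t a * star u := by
  let _ : NormedAlgebra ℚ A := .restrictScalars ℚ ℂ A
  have hu₁ : star u * u = 1 := Unitary.star_mul_self_of_mem hu
  have hexp (x : A) : NormedSpace.exp (u * x * star u) = u * NormedSpace.exp x * star u :=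
    NormedSpace.exp_units_conj (Unitary.toUnits ⟨u, hu⟩) x
  have hlog {p : A} (hp : IsStrictlyPositive p) :
      CFC.log (u * p * star u) = u * CFC.log p * star u := by
    rw [← CFC.log_exp (u * CFC.log p * star u) (IsSelfAdjoint.log.conjugate _), hexp, CFC.exp_log p]
  have e : u * a * star u * star (u * a * star u) = u * (a * star a) * star u := by
    simp only [star_mul, star_star, mul_assoc]
    rw [← mul_assoc (star u) u, hu₁, one_mul]
  rw [polarScale, e, hlog ha.isStrictlyPositive_mul_star_self, ← smul_mul_assoc,
    ← mul_smul_comm, hexp, polarScale]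
  simp only [mul_assoc]
  rw [← mul_assoc (star u) u, hu₁, one_mul]

end Order

lemma continuousOn_polarScale :
    ContinuousOn (fun x : ℝ × A ↦ polarScale x.1 x.2) {x | IsUnit x.2} := by
  let _ : NormedAlgebra ℚ A := .restrictScalars ℚ ℂ A
  have h : ContinuousOn (fun x : ℝ × A ↦ CFC.log (x.2 * star x.2)) {x | IsUnit x.2} :=
    CFC.continuousOn_log.comp (by fun_prop)
      fun x hx ↦ ⟨IsSelfAdjoint.mul_star_self _, IsUnit.mul hx (IsUnit.star hx)⟩
  unfold polarScale
  refine ContinuousOn.mul (NormedSpace.exp_continuous.comp_continuousOn ?_) (by fun_prop)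
  have hr : ContinuousOn (fun x : ℝ × A ↦ -(x.1 / 2)) {x | IsUnit x.2} := by fun_prop
  exact hr.smul h

lemma Continuous.polarScale {X : Type*} [TopologicalSpace X] {t : X → ℝ} {a : X → A}
    (ht : Continuous t) (ha : Continuous a) (hu : ∀ x, IsUnit (a x)) :
    Continuous fun x ↦ polarScale (t x) (a x) :=
  continuousOn_polarScale.comp_continuous (ht.prodMk ha) hu

end CStarAlgebra

section Nilpotent

open scoped ComplexOrder in
/-- If conjugation by `B` multiplies `A Aᴴ` by a Hermitian matrix commuting with `A` and `B`, then
that matrix is trivial. -/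
lemma Matrix.eq_one_of_conj_mul_conjTranspose {m : Type*} [Fintype m] [DecidableEq m]
    {A B Q : Matrix m m ℂ} (hA : IsUnit A) (hB : IsUnit B) (hQ : Q.IsHermitian)
    (hQA : Commute Q A) (hQB : Commute Q B) (h : B * (A * Aᴴ) = A * Aᴴ * Q * B) : Q = 1 := by
  obtain ⟨b, rfl⟩ := hB
  obtain ⟨a, rfl⟩ := hA
  have htr (X : Matrix m m ℂ) : (b * X * (b⁻¹ : (Matrix m m ℂ)ˣ)).trace = X.trace := by
    rw [trace_mul_comm, ← mul_assoc]; simp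
  set S := (a : Matrix m m ℂ) * (a : Matrix m m ℂ)ᴴ with hS
  have h₁ : (S * Q).trace = S.trace := by
    rw [← htr S, h, mul_assoc]; simp
  have h₂ : (S * Q * Q).trace = S.trace := by
    rw [← h₁, ← htr (S * Q), ← mul_assoc (b : Matrix m m ℂ), h, mul_assoc _ (b : Matrix m m ℂ) Q,
      ← hQB.eq, ← mul_assoc, mul_assoc _ (b : Matrix m m ℂ)]
    simp
  have h₃ : (((Q - 1) * a.1)ᴴ * ((Q - 1) * a.1)).trace = 0 := by
    have e : S * ((Q - 1) * (Q - 1)) = S * Q * Q - S * Q - (S * Q - S) := by noncomm_ring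
    rw [conjTranspose_mul, conjTranspose_sub, hQ.eq, conjTranspose_one, mul_assoc,
      trace_mul_comm, ← mul_assoc, mul_assoc _ a.1, trace_mul_comm, ← hS, e]
    simp [h₁, h₂]
  rw [trace_conjTranspose_mul_self_eq_zero_iff] at h₃
  exact sub_eq_zero.mp ((Units.mul_left_eq_zero a).mp h₃)

open scoped Matrix.Norms.L2Operator in
/-- For a normal-valued representation of a nilpotent group, the positive part of each value
commutes with all values. -/
lemma NormalRep.commute_mul_star_self {Γ : Type} [Group Γ] [Group.IsNilpotent Γ] {n : ℕ}
    (ρ : NormalRep Γ n) (a b : Γ) : Commute (ρ.1 a * star (ρ.1 a)) (ρ.1 b) := by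
  obtain ⟨f, ⟨h_one, h_mul, h_unit⟩, h_normal⟩ := ρ
  have hn (γ : Γ) : IsStarNormal (f γ) := ⟨(h_normal γ).symm⟩
  obtain ⟨k, hk⟩ := Group.IsNilpotent.nilpotent Γ
  suffices H : ∀ i, ∀ a ∈ Subgroup.upperCentralSeries Γ i, ∀ b,
      Commute (f a * star (f a)) (f b) from H k a (hk ▸ Subgroup.mem_top a) b
  intro i
  induction i with
  | zero =>
    intro a ha b
    obtain rfl : a = 1 := by simpa using ha
    simp [h_one]
  | succ i ih =>
    intro a ha b
    have hc := Subgroup.mem_upperCentralSeries_succ_iff.mp (inv_mem ha) b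
    rw [commutatorElement_def, inv_inv] at hc
    set c := a⁻¹ * b * a * b⁻¹ with hcdef
    have hbac : b * a = a * c * b := by rw [hcdef]; group
    have hQ := ih c hc
    have hsemi : SemiconjBy (f b) (f a) (f (a * c)) := by
      rw [SemiconjBy, ← h_mul, ← h_mul, hbac]
    have hsemi' := hsemi.star_right (hn _) (hn _)
    have key : f b * (f a * star (f a)) = f a * star (f a) * (f c * star (f c)) * f b := by
      have hQ' : Commute (f c * star (f c)) (star (f a)) := by
        simpa using (hQ a).star_star
      rw [(hsemi.mul_right hsemi').eq, h_mul, star_mul, mul_assoc (f a) (star (f a)), ← hQ'.eq]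
      simp only [mul_assoc]
    have hone : f c * star (f c) = 1 :=
      Matrix.eq_one_of_conj_mul_conjTranspose (h_unit a) (h_unit b)
        (isHermitian_mul_conjTranspose_self (f c)) (hQ a) (hQ b) key
    rw [hone, mul_one] at key
    exact key.symm

end Nilpotent

open scoped Matrix.Norms.L2Operator MatrixOrder in
/-- Scaling the eigenvalues of all values of a normal-valued representation. -/
noncomputable def NormalRep.polarScale {Γ : Type} [Group Γ] [Group.IsNilpotent Γ] {n : ℕ} (t : ℝ)
    (ρ : NormalRep Γ n) : NormalRep Γ n :=
  ⟨fun γ ↦ _root_.polarScale t (ρ.1 γ),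
    ⟨by
      beta_reduce
      rw [ρ.2.1.1]
      exact polarScale_of_mul_star_self (by simp) t,
    fun γ δ ↦ by
      beta_reduce
      rw [ρ.2.1.2.1, polarScale_mul (ρ.2.1.2.2 γ) (ρ.2.1.2.2 δ) (ρ.commute_mul_star_self δ γ)],
    fun γ ↦ (ρ.2.1.2.2 γ).polarScale t⟩,
    fun γ ↦ (isStarNormal_polarScale ⟨(ρ.2.2 γ).symm⟩ t).star_comm_self.eq.symm⟩

/-- Proposition 5.2 of the paper: for a finitely generated nilpotent group `Γ`, there is a
`U(n)`-equivariant strong deformation retraction of the Kempf–Ness set `𝓜` of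
`Hom(Γ, GL_n ℂ)` (the normal-valued representations) onto `Hom(Γ, U(n))`. -/
theorem kempfNess_retracts_to_unitary (Γ : Type) [Group Γ] [Group.FG Γ]
    [Group.IsNilpotent Γ] (n : ℕ) (hn : 1 ≤ n) :
    ∃ H : NormalRep Γ n × unitInterval → NormalRep Γ n,
      Continuous H ∧
      (∀ x, H (x, 0) = x) ∧
      (∀ x γ, (H (x, 1)).1 γ ∈ Matrix.unitaryGroup (Fin n) ℂ) ∧
      (∀ a : NormalRep Γ n, (∀ γ, a.1 γ ∈ Matrix.unitaryGroup (Fin n) ℂ) →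
        ∀ t, H (a, t) = a) ∧
      (∀ u : Matrix.unitaryGroup (Fin n) ℂ, ∀ ρ σ : NormalRep Γ n,
        (∀ γ, σ.1 γ =
            (u : Matrix (Fin n) (Fin n) ℂ) * ρ.1 γ * star (u : Matrix (Fin n) (Fin n) ℂ)) →
        ∀ t γ, (H (σ, t)).1 γ =
            (u : Matrix (Fin n) (Fin n) ℂ) * (H (ρ, t)).1 γ *
              star (u : Matrix (Fin n) (Fin n) ℂ)) := by
  open scoped Matrix.Norms.L2Operator MatrixOrder in
  refine ⟨fun x ↦ x.1.polarScale x.2, ?_, ?_, ?_, ?_, ?_⟩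
  · refine Continuous.subtype_mk (continuous_pi fun γ ↦ ?_) _
    exact Continuous.polarScale (continuous_subtype_val.comp continuous_snd)
      ((continuous_apply γ).comp (continuous_subtype_val.comp continuous_fst))
      fun x ↦ x.1.2.1.2.2 γ
  · exact fun x ↦ Subtype.ext (funext fun γ ↦ polarScale_zero _)
  · exact fun x γ ↦ mem_unitaryGroup_iff.mpr
      (polarScale_one_mul_star_self (x.2.1.2.2 γ))
  · exact fun a ha t ↦ Subtype.ext (funext fun γ ↦
      polarScale_of_mul_star_self (mem_unitaryGroup_iff.mp (ha γ)) _)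
  · intro u ρ σ h t γ
    change polarScale _ (σ.1 γ) = _
    rw [h γ]
    exact polarScale_unitary_conj u.2 (ρ.2.1.2.2 γ) _
end

section
/- Let Γ be a nilpotent group generated by finitely many elements γ₁, …, γ_r, let n ≥ 1, and let ρ : Γ → GL_n(ℂ) be a group homomorphism. If the orbit {(g·ρ(γ₁)·g⁻¹, …, g·ρ(γ_r)·g⁻¹) : g ∈ GL_n(ℂ)} is a closed subset of the product space M_n(ℂ)^r (with its natural Euclidean topology), then there exists h ∈ GL_n(ℂ) such that h·ρ(γ)·h⁻¹ is a normal matrix for every γ ∈ Γ. -/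
open Matrix
open scoped commutatorElement

theorem commutatorElement_pow_left_of_mem_center {G : Type*} [Group G] {z g : G}
    (h : ⁅z, g⁆ ∈ Subgroup.center G) (N : ℕ) : ⁅z ^ N, g⁆ = ⁅z, g⁆ ^ N := by
  induction N with
  | zero => simp
  | succ k ih =>
    have hc := Subgroup.mem_center_iff.mp h
    calc ⁅z ^ (k + 1), g⁆ = z * ⁅z ^ k, g⁆ * z⁻¹ * ⁅z, g⁆ := by
          simp only [commutatorElement_def]; group
      _ = ⁅z, g⁆ ^ (k + 1) := by
          rw [ih, Subgroup.mem_center_iff.mp (Subgroup.pow_mem _ h k) z]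
          rw [mul_inv_cancel_right, pow_succ]

/-- If central commutators have exponent `N`, so do the higher upper central factors. -/
theorem pow_mem_upperCentralSeries {G : Type*} [Group G] {N : ℕ}
    (H : ∀ z g : G, ⁅z, g⁆ ∈ Subgroup.center G → ⁅z, g⁆ ^ N = 1) (i : ℕ) :
    ∀ z ∈ Subgroup.upperCentralSeries G (i + 2), z ^ N ∈ Subgroup.upperCentralSeries G (i + 1) := by
  induction i with
  | zero =>
    intro z hz
    rw [zero_add, Subgroup.upperCentralSeries_one, Subgroup.mem_center_iff]
    intro g
    have hzg := Subgroup.mem_upperCentralSeries_succ_iff.mp hz g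
    rw [Subgroup.upperCentralSeries_one] at hzg
    have := commutatorElement_pow_left_of_mem_center hzg N
    rw [H z g hzg, commutatorElement_eq_one_iff_mul_comm] at this
    exact this.symm
  | succ i ih =>
    intro z hz
    refine Subgroup.mem_upperCentralSeries_succ_iff.mpr fun g ↦ ?_
    have hzg := Subgroup.mem_upperCentralSeries_succ_iff.mp hz g
    let q := QuotientGroup.mk' (Subgroup.upperCentralSeries G (i + 1))
    have hcen : ⁅q z, q g⁆ ∈ Subgroup.center (G ⧸ Subgroup.upperCentralSeries G (i + 1)) := by
      refine Subgroup.mem_center_iff.mpr fun x ↦ ?_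
      obtain ⟨x, rfl⟩ := QuotientGroup.mk'_surjective _ x
      rw [← map_commutatorElement, eq_comm, ← commutatorElement_eq_one_iff_mul_comm]
      refine (map_commutatorElement q ⁅z, g⁆ x).symm.trans ?_
      exact (QuotientGroup.eq_one_iff _).mpr (Subgroup.mem_upperCentralSeries_succ_iff.mp hzg x)
    have h := commutatorElement_pow_left_of_mem_center hcen N
    rw [← map_commutatorElement, ← map_pow, ← map_pow, ← map_commutatorElement] at h
    have h1 : q (⁅z, g⁆ ^ N) = 1 := (QuotientGroup.eq_one_iff _).mpr (ih _ hzg)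
    exact (QuotientGroup.eq_one_iff _).mp (h.trans h1)

theorem exists_pow_mem_center {G : Type*} [Group G] [Group.IsNilpotent G] {N : ℕ} (hN : 0 < N)
    (H : ∀ z g : G, ⁅z, g⁆ ∈ Subgroup.center G → ⁅z, g⁆ ^ N = 1) (x : G) :
    ∃ k, 0 < k ∧ x ^ k ∈ Subgroup.center G := by
  have key : ∀ i, ∀ x ∈ Subgroup.upperCentralSeries G (i + 1),
      ∃ k, 0 < k ∧ x ^ k ∈ Subgroup.center G := by
    intro i
    induction i with
    | zero =>
      intro x hx
      exact ⟨1, one_pos, by simpa using hx⟩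
    | succ i ih =>
      intro x hx
      obtain ⟨k, hk, h⟩ := ih _ (pow_mem_upperCentralSeries H i x hx)
      exact ⟨N * k, Nat.mul_pos hN hk, by rwa [pow_mul]⟩
  obtain ⟨n, hn⟩ := Group.IsNilpotent.nilpotent G
  exact key n x (Subgroup.upperCentralSeries_mono G n.le_succ (hn ▸ Subgroup.mem_top x))

theorem finite_of_fg_of_isNilpotent_of_torsion (G : Type*) [Group G] [Group.IsNilpotent G]
    (hfg : Group.FG G) (ht : IsMulTorsion G) : Finite G := by
  refine Group.nilpotent_center_quotient_ind
    (P := fun G _ _ ↦ Group.FG G → IsMulTorsion G → Finite G) G ?_ ?_ hfg ht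
  · intros
    infer_instance
  · intro G _ _ ih hfg ht
    have hfin : Finite (G ⧸ Subgroup.center G) := ih inferInstance (ht.of_surjective (QuotientGroup.mk'_surjective _))
    have : (Subgroup.center G).FiniteIndex := Subgroup.finiteIndex_of_finite_quotient
    open scoped IsMulCommutative in
    have : Finite (Subgroup.center G) := by
      exact CommGroup.finite_of_fg_isMulTorsion _ (ht.subgroup _)
    exact Finite.of_subgroup_quotient (Subgroup.center G)

section
variable {n : Type*} [Fintype n]

open scoped MatrixOrder ComplexOrder in
theorem Matrix.PosDef.exists_mul_self_eq [DecidableEq n] {P : Matrix n n ℂ} (hP : P.PosDef) :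
    ∃ S : Matrix n n ℂ, S.PosDef ∧ S * S = P := by
  have h := CFC.sqrt_mul_sqrt_self P hP.posSemidef.nonneg
  refine ⟨CFC.sqrt P, ?_, h⟩
  refine (CFC.sqrt_nonneg P).posSemidef.posDef_iff_isUnit.mpr ?_
  exact ((Commute.refl _).isUnit_mul_iff.mp (h.symm ▸ hP.isUnit)).1

/-- The squared Frobenius norm of a complex matrix. -/
noncomputable def frobSq (X : Matrix n n ℂ) : ℝ := (Xᴴ * X).trace.re

theorem frobSq_eq_sum (X : Matrix n n ℂ) : frobSq X = ∑ i, ∑ j, ‖X i j‖ ^ 2 := by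
  rw [Finset.sum_comm]
  simp [frobSq, Matrix.trace, Matrix.mul_apply, ← Complex.normSq_eq_norm_sq, Complex.normSq_apply]

theorem frobSq_nonneg (X : Matrix n n ℂ) : 0 ≤ frobSq X := by
  rw [frobSq_eq_sum]; positivity

theorem eq_zero_of_frobSq_eq_zero {X : Matrix n n ℂ} (h : frobSq X = 0) : X = 0 := by
  rw [frobSq_eq_sum, Finset.sum_eq_zero_iff_of_nonneg fun _ _ ↦ by positivity] at h
  ext i j
  have := h i (Finset.mem_univ i)
  rw [Finset.sum_eq_zero_iff_of_nonneg fun _ _ ↦ by positivity] at this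
  simpa using this j (Finset.mem_univ j)

theorem norm_sq_apply_le_frobSq (X : Matrix n n ℂ) (i j : n) : ‖X i j‖ ^ 2 ≤ frobSq X := by
  rw [frobSq_eq_sum]
  exact (Finset.single_le_sum (f := fun j ↦ ‖X i j‖ ^ 2) (fun _ _ ↦ by positivity)
    (Finset.mem_univ j)).trans (Finset.single_le_sum (f := fun i ↦ ∑ j, ‖X i j‖ ^ 2)
      (fun _ _ ↦ by positivity) (Finset.mem_univ i))

theorem continuous_frobSq : Continuous (frobSq (n := n)) := by
  unfold frobSq; fun_prop

variable [DecidableEq n]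

/-- The Frobenius norm of `g * X * g⁻¹` depends only on `gᴴ * g`. -/
theorem frobSq_conj (g X : Matrix n n ℂ) :
    frobSq (g * X * g⁻¹) = ((gᴴ * g)⁻¹ * Xᴴ * (gᴴ * g) * X).trace.re := by
  have : (g * X * g⁻¹)ᴴ * (g * X * g⁻¹) = (gᴴ)⁻¹ * (Xᴴ * (gᴴ * g) * X * g⁻¹) := by
    simp only [conjTranspose_mul, conjTranspose_nonsing_inv]
    noncomm_ring
  rw [frobSq, this, trace_mul_comm, Matrix.mul_assoc, trace_mul_comm, Matrix.mul_inv_rev]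
  simp only [Matrix.mul_assoc]

/-- Second difference of the Frobenius norm along a geodesic of conjugates. -/
theorem frobSq_conj_add_frobSq_conj {S : Matrix n n ℂ} (hS : S.IsHermitian) (hu : IsUnit S)
    (B : Matrix n n ℂ) :
    frobSq (S⁻¹ * B * S) + frobSq (S * B * S⁻¹) =
      2 * frobSq B + frobSq (S * B * S⁻¹ - S⁻¹ * B * S) := by
  have hSi : (S⁻¹)ᴴ = S⁻¹ := hS.inv
  have hd := (Matrix.isUnit_iff_isUnit_det S).mp hu
  have e1 : ((S * B * S⁻¹)ᴴ * (S⁻¹ * B * S)).trace = (Bᴴ * B).trace := by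
    simp only [conjTranspose_mul, hSi, hS.eq]
    rw [show S⁻¹ * (Bᴴ * S) * (S⁻¹ * B * S) = S⁻¹ * (Bᴴ * (S * S⁻¹) * B * S) by noncomm_ring,
      trace_mul_comm, mul_nonsing_inv _ hd, Matrix.mul_one, mul_nonsing_inv_cancel_right _ _ hd]
  have e2 : ((S⁻¹ * B * S)ᴴ * (S * B * S⁻¹)).trace = (Bᴴ * B).trace := by
    simp only [conjTranspose_mul, hSi, hS.eq]
    rw [show S * (Bᴴ * S⁻¹) * (S * B * S⁻¹) = S * (Bᴴ * (S⁻¹ * S) * B * S⁻¹) by noncomm_ring,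
      trace_mul_comm, nonsing_inv_mul _ hd, Matrix.mul_one, nonsing_inv_mul_cancel_right _ _ hd]
  simp only [frobSq, conjTranspose_sub, Matrix.sub_mul, Matrix.mul_sub, trace_sub, e1, e2,
    Complex.sub_re]
  ring

open scoped ComplexOrder in
/-- Uniqueness of minimal vectors up to unitaries and stabilisers. -/
theorem commute_conjTranspose_mul_self_of_minimal {ι : Type*} {T : Finset ι}
    {A : ι → Matrix n n ℂ}
    (hmin : ∀ x : Matrix n n ℂ, IsUnit x →
      ∑ t ∈ T, frobSq (A t) ≤ ∑ t ∈ T, frobSq (x * A t * x⁻¹))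
    {g : Matrix n n ℂ} (hg : IsUnit g)
    (h : ∑ t ∈ T, frobSq (g * A t * g⁻¹) = ∑ t ∈ T, frobSq (A t)) {t : ι} (ht : t ∈ T) :
    Commute (gᴴ * g) (A t) := by
  have hP : (gᴴ * g).PosDef := .conjTranspose_mul_self _ (mulVec_injective_iff_isUnit.mpr hg)
  obtain ⟨R, hR, hRP⟩ := hP.exists_mul_self_eq
  obtain ⟨S, hS, rfl⟩ := hR.exists_mul_self_eq
  have hu := hS.isUnit
  have hd := (Matrix.isUnit_iff_isUnit_det S).mp hu
  have hgS (t) : frobSq (g * A t * g⁻¹) = frobSq (S * (S * A t * S⁻¹) * S⁻¹) := by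
    have : S * (S * A t * S⁻¹) * S⁻¹ = (S * S) * A t * (S * S)⁻¹ := by
      rw [Matrix.mul_inv_rev]; noncomm_ring
    rw [this, frobSq_conj, frobSq_conj, hR.isHermitian.eq, hRP]
  have hA (t) : S⁻¹ * (S * A t * S⁻¹) * S = A t := by
    rw [show S⁻¹ * (S * A t * S⁻¹) * S = (S⁻¹ * S) * A t * (S⁻¹ * S) by noncomm_ring,
      nonsing_inv_mul _ hd, Matrix.one_mul, Matrix.mul_one]
  have key : ∑ t ∈ T, frobSq (S * (S * A t * S⁻¹) * S⁻¹ - A t) ≤ 0 := by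
    have h1 := Finset.sum_congr (s₁ := T) rfl fun t _ ↦
      frobSq_conj_add_frobSq_conj hS.isHermitian hu (S * A t * S⁻¹)
    simp only [hA, ← hgS, Finset.sum_add_distrib, ← Finset.mul_sum] at h1
    linarith [hmin S hu]
  have h0 := (Finset.sum_eq_zero_iff_of_nonneg fun t _ ↦ frobSq_nonneg _).mp
    (key.antisymm (Finset.sum_nonneg fun t _ ↦ frobSq_nonneg _)) t ht
  have h2 := sub_eq_zero.mp (eq_zero_of_frobSq_eq_zero h0)
  have h3 : Commute (S * S) (A t) := by
    have : S * S * A t = S * (S * A t * S⁻¹) * S⁻¹ * (S * S) := by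
      rw [show S * (S * A t * S⁻¹) * S⁻¹ * (S * S) = S * (S * A t * (S⁻¹ * (S⁻¹ * S) * S)) by
        noncomm_ring, nonsing_inv_mul _ hd, Matrix.mul_one, nonsing_inv_mul _ hd, Matrix.mul_one,
        Matrix.mul_assoc]
    rwa [h2] at this
  rw [← hRP]
  exact h3.mul_left h3

end

section
open scoped Matrix.Norms.L2Operator

theorem IsStarNormal.pow_eq_one_of_spectrum {n : Type*} [Fintype n] [DecidableEq n]
    {P : Matrix n n ℂ} (hP : IsStarNormal P) (N : ℕ)
    (h : ∀ μ ∈ spectrum ℂ P, μ ^ N = 1) : P ^ N = 1 := by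
  rw [← cfc_pow_id (R := ℂ) P N, cfc_congr (g := fun _ ↦ 1) h, cfc_const_one ..]

end

theorem pow_finrank_eq_one {V : Type*} [AddCommGroup V] [Module ℂ V] [FiniteDimensional ℂ V]
    {z g c : Module.End ℂ V} (hz : Function.Injective z) (hg : Function.Injective g)
    (hcz : Commute c z) (hcg : Commute c g) (h : z * g = c * (g * z)) (μ : ℂ) :
    μ ^ Module.finrank ℂ (c.eigenspace μ) = 1 := by
  have mz : ∀ x ∈ c.eigenspace μ, z x ∈ c.eigenspace μ := fun x hx ↦ by
    rw [Module.End.mem_eigenspace_iff] at hx ⊢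
    rw [← Module.End.mul_apply, hcz.eq, Module.End.mul_apply, hx, map_smul]
  have mg : ∀ x ∈ c.eigenspace μ, g x ∈ c.eigenspace μ := fun x hx ↦ by
    rw [Module.End.mem_eigenspace_iff] at hx ⊢
    rw [← Module.End.mul_apply, hcg.eq, Module.End.mul_apply, hx, map_smul]
  have e : z.restrict mz * g.restrict mg = μ • (g.restrict mg * z.restrict mz) := by
    ext x
    have := LinearMap.congr_fun h x
    simp only [Module.End.mul_apply] at this
    have h2 := Module.End.mem_eigenspace_iff.mp (mg _ (mz _ x.2))
    simp [this, h2]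
  have e' := congrArg LinearMap.det e
  rw [map_mul, LinearMap.det_smul, map_mul, mul_comm (LinearMap.det (z.restrict mz))] at e'
  have n0 (f : Module.End ℂ V) (hf : Function.Injective f) (mf) :
      LinearMap.det (f.restrict mf : Module.End ℂ (c.eigenspace μ)) ≠ 0 := by
    have hi : Function.Injective (f.restrict mf : Module.End ℂ (c.eigenspace μ)) :=
      fun x y hxy ↦ Subtype.ext (hf (congrArg Subtype.val hxy))
    exact (((LinearMap.isUnit_iff_ker_eq_bot _).mpr (LinearMap.ker_eq_bot.mpr hi)).map
      LinearMap.det).ne_zero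
  exact (mul_right_cancel₀ (mul_ne_zero (n0 g hg mg) (n0 z hz mz)) (by rw [one_mul]; exact e')).symm

section
variable {Γ n : Type*} [Group Γ] [Fintype n] [DecidableEq n]

/-- The tuple `(ρ t)_{t ∈ T}` has minimal Frobenius norm in its simultaneous-conjugation orbit. -/
def IsMinimalOn (ρ : Γ →* (Matrix n n ℂ)ˣ) (T : Finset Γ) : Prop :=
  ∀ x : (Matrix n n ℂ)ˣ, ∑ t ∈ T, frobSq (ρ t : Matrix n n ℂ) ≤
    ∑ t ∈ T, frobSq ((x * ρ t * x⁻¹ : (Matrix n n ℂ)ˣ) : Matrix n n ℂ)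

/-- At a minimal generating tuple, every element permuting the tuple by conjugation is normal. -/
theorem IsMinimalOn.isStarNormal {ρ : Γ →* (Matrix n n ℂ)ˣ} {T : Finset Γ} (h : IsMinimalOn ρ T)
    (hT : Subgroup.closure (T : Set Γ) = ⊤) {γ : Γ} (h₁ : ∀ t ∈ T, γ * t * γ⁻¹ ∈ T)
    (h₂ : ∀ t ∈ T, γ⁻¹ * t * γ ∈ T) : IsStarNormal (ρ γ : Matrix n n ℂ) := by
  set P := (ρ γ : Matrix n n ℂ)ᴴ * (ρ γ : Matrix n n ℂ) with hP
  have hgen : ∀ t ∈ T, Commute P (ρ t : Matrix n n ℂ) := by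
    refine fun t ht ↦ commute_conjTranspose_mul_self_of_minimal
      (A := fun t ↦ (ρ t : Matrix n n ℂ)) (fun x hx ↦ ?_) (ρ γ).isUnit ?_ ht
    · obtain ⟨x, rfl⟩ := hx
      simpa only [Units.val_mul, coe_units_inv] using h x
    · refine Finset.sum_nbij' (fun t ↦ γ * t * γ⁻¹) (fun t ↦ γ⁻¹ * t * γ) h₁ h₂ ?_ ?_ ?_
      · intros; group
      · intros; group
      · intros; simp
  have hall : ∀ x, Commute P (ρ x : Matrix n n ℂ) := fun x ↦ by
    have hx : x ∈ Subgroup.closure (T : Set Γ) := hT ▸ Subgroup.mem_top x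
    induction hx using Subgroup.closure_induction with
    | mem x hx => exact hgen x hx
    | one => simp
    | mul x y _ _ hx hy => simpa using hx.mul_right hy
    | inv x _ hx => rw [map_inv]; exact hx.units_inv_right
  refine ⟨?_⟩
  have := (hall γ).eq
  rw [hP, ← Matrix.mul_assoc] at this
  exact (ρ γ).isUnit.mul_right_cancel this

/-- Conjugates of `ρ γ` depend continuously on the conjugated tuple of generators. -/
theorem exists_continuous_map_conj {r : ℕ} {c : Fin r → Γ}
    (hc : Subgroup.closure (Set.range c) = ⊤) (ρ : Γ →* (Matrix n n ℂ)ˣ) (γ : Γ) :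
    ∃ f : (Fin r → Matrix n n ℂ) → Matrix n n ℂ, Continuous f ∧ ∀ g : (Matrix n n ℂ)ˣ,
      f (fun i ↦ ((g * ρ (c i) * g⁻¹ : (Matrix n n ℂ)ˣ) : Matrix n n ℂ)) =
        ((g * ρ γ * g⁻¹ : (Matrix n n ℂ)ˣ) : Matrix n n ℂ) := by
  have hγ : γ ∈ Subgroup.closure (Set.range c) := hc ▸ Subgroup.mem_top γ
  induction hγ using Subgroup.closure_induction with
  | mem x hx =>
    obtain ⟨i, rfl⟩ := hx
    exact ⟨fun v ↦ v i, by fun_prop, fun g ↦ rfl⟩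
  | one => exact ⟨fun _ ↦ 1, by fun_prop, fun g ↦ by simp⟩
  | mul x y _ _ hx hy =>
    obtain ⟨f₁, hf₁, h₁⟩ := hx
    obtain ⟨f₂, hf₂, h₂⟩ := hy
    refine ⟨fun v ↦ f₁ v * f₂ v, by fun_prop, fun g ↦ ?_⟩
    simp only [h₁, h₂, ← Units.val_mul, map_mul]
    congr 1
    group
  | inv x _ hx =>
    obtain ⟨f, hf, h⟩ := hx
    refine ⟨fun v ↦ (ρ x : Matrix n n ℂ).det⁻¹ • (f v).adjugate,
      hf.matrix_adjugate.const_smul (ρ x : Matrix n n ℂ).det⁻¹, fun g ↦ ?_⟩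
    have e : (g * ρ x⁻¹ * g⁻¹ : (Matrix n n ℂ)ˣ) = (g * ρ x * g⁻¹)⁻¹ := by
      rw [map_inv]; group
    have hd : (((g * ρ x * g⁻¹ : (Matrix n n ℂ)ˣ) : Matrix n n ℂ)).det
        = (ρ x : Matrix n n ℂ).det := by
      simp only [Units.val_mul, coe_units_inv, det_conj g.isUnit]
    beta_reduce
    rw [e, coe_units_inv, h, Matrix.inv_def, hd, Ring.inverse_eq_inv']

/-- A closed orbit contains a minimal tuple, also for a larger finite set of group elements. -/
theorem exists_isMinimalOn_conj {r : ℕ} {c : Fin r → Γ}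
    (hc : Subgroup.closure (Set.range c) = ⊤) (ρ : Γ →* (Matrix n n ℂ)ˣ)
    (hclosed : IsClosed {v : Fin r → Matrix n n ℂ | ∃ g : (Matrix n n ℂ)ˣ, ∀ i,
      v i = ((g * ρ (c i) * g⁻¹ : (Matrix n n ℂ)ˣ) : Matrix n n ℂ)})
    {T : Finset Γ} (hT : ∀ i, c i ∈ T) :
    ∃ h : (Matrix n n ℂ)ˣ, IsMinimalOn ((MulAut.conj h).toMonoidHom.comp ρ) T := by
  choose f hf hfρ using exists_continuous_map_conj hc ρ
  let F : (Fin r → Matrix n n ℂ) → ℝ := fun v ↦ ∑ t ∈ T, frobSq (f t v)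
  have hF : Continuous F := continuous_finsetSum _ fun t _ ↦ continuous_frobSq.comp (hf t)
  let o : (Matrix n n ℂ)ˣ → Fin r → Matrix n n ℂ :=
    fun g i ↦ ((g * ρ (c i) * g⁻¹ : (Matrix n n ℂ)ˣ) : Matrix n n ℂ)
  have hFo (g) : F (o g) = ∑ t ∈ T, frobSq ((g * ρ t * g⁻¹ : (Matrix n n ℂ)ˣ) : Matrix n n ℂ) :=
    Finset.sum_congr rfl fun t _ ↦ by rw [hfρ]
  let B : Set (Fin r → Matrix n n ℂ) := Set.univ.pi fun _ ↦
    (Set.univ.pi fun _ ↦ Set.univ.pi fun _ ↦ Metric.closedBall 0 √(F (o 1)) : Set (n → n → ℂ))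
  have hB : IsCompact B := isCompact_univ_pi fun _ ↦ isCompact_univ_pi fun _ ↦
    isCompact_univ_pi fun _ ↦ isCompact_closedBall _ _
  have hmem (g) (hg : F (o g) ≤ F (o 1)) : o g ∈ B := by
    intro i _ k _ l _
    rw [mem_closedBall_zero_iff]
    refine Real.le_sqrt_of_sq_le ((norm_sq_apply_le_frobSq _ k l).trans (le_trans ?_ hg))
    rw [hFo]
    exact Finset.single_le_sum (f := fun t ↦ frobSq ((g * ρ t * g⁻¹ : (Matrix n n ℂ)ˣ) :
      Matrix n n ℂ)) (fun _ _ ↦ frobSq_nonneg _) (hT i)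
  obtain ⟨v, ⟨hvB, h, hv⟩, hmin⟩ := (hB.inter_right hclosed).exists_isMinOn
    ⟨o 1, hmem 1 le_rfl, 1, fun _ ↦ rfl⟩ hF.continuousOn
  obtain rfl : v = o h := funext hv
  have hle (g) : F (o h) ≤ F (o g) := by
    by_cases hg : F (o g) ≤ F (o 1)
    · exact hmin ⟨hmem g hg, g, fun _ ↦ rfl⟩
    · exact (hmin ⟨hmem 1 le_rfl, 1, fun _ ↦ rfl⟩ : F (o h) ≤ F (o 1)).trans (not_le.mp hg).le
  refine ⟨h, fun x ↦ ?_⟩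
  have := hle (x * h)
  simp only [hFo] at this
  simpa [mul_assoc] using this

theorem pow_factorial_eq_one {z g c : (Matrix n n ℂ)ˣ} (hc : IsStarNormal (c : Matrix n n ℂ))
    (hcz : Commute c z) (hcg : Commute c g) (h : z * g = c * (g * z)) :
    c ^ (Fintype.card n).factorial = 1 := by
  have inj (x : (Matrix n n ℂ)ˣ) : Function.Injective (toLin' (x : Matrix n n ℂ)) :=
    mulVec_injective_iff_isUnit.mpr x.isUnit
  have com {x y : (Matrix n n ℂ)ˣ} (h : Commute x y) :
      Commute (toLin' (x : Matrix n n ℂ)) (toLin' (y : Matrix n n ℂ)) := by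
    have := congrArg (fun x : (Matrix n n ℂ)ˣ ↦ toLin' (x : Matrix n n ℂ)) h.eq
    simp only [Units.val_mul, toLin'_mul] at this
    exact this
  refine Units.ext ((Units.val_pow_eq_pow_val _ _).trans (hc.pow_eq_one_of_spectrum _ fun μ hμ ↦ ?_))
  rw [← spectrum_toLin', ← Module.End.hasEigenvalue_iff_mem_spectrum] at hμ
  have hd := pow_finrank_eq_one (inj z) (inj g) (com hcz) (com hcg) (by
    have := congrArg (fun x : (Matrix n n ℂ)ˣ ↦ toLin' (x : Matrix n n ℂ)) h
    simp only [Units.val_mul, toLin'_mul] at this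
    exact this) μ
  have hpos : 0 < Module.finrank ℂ (Module.End.eigenspace (toLin' (c : Matrix n n ℂ)) μ) :=
    Submodule.one_le_finrank_iff.mpr hμ
  have hle := Submodule.finrank_le (Module.End.eigenspace (toLin' (c : Matrix n n ℂ)) μ)
  rw [Module.finrank_fintype_fun_eq_card] at hle
  obtain ⟨k, hk⟩ := Nat.dvd_factorial hpos hle
  rw [hk, pow_mul, hd, one_pow]

theorem finite_quotient_center {r : ℕ} {c : Fin r → Γ} [Group.IsNilpotent Γ]
    (hc : Subgroup.closure (Set.range c) = ⊤) {ρ : Γ →* (Matrix n n ℂ)ˣ}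
    (hρ : Function.Injective ρ)
    (hnormal : ∀ γ ∈ Subgroup.center Γ, IsStarNormal (ρ γ : Matrix n n ℂ)) :
    Finite (Γ ⧸ Subgroup.center Γ) := by
  have : Group.FG Γ := Group.fg_iff.mpr ⟨_, hc, Set.finite_range c⟩
  refine finite_of_fg_of_isNilpotent_of_torsion _ inferInstance fun q ↦ ?_
  obtain ⟨x, rfl⟩ := QuotientGroup.mk'_surjective _ q
  have hpow : ∀ z g : Γ, ⁅z, g⁆ ∈ Subgroup.center Γ →
      ⁅z, g⁆ ^ (Fintype.card n).factorial = 1 := fun z g h ↦ hρ <| by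
    have hcomm (y) : Commute (ρ ⁅z, g⁆) (ρ y) :=
      (show Commute ⁅z, g⁆ y from (Subgroup.mem_center_iff.mp h y).symm).map ρ
    rw [map_pow, map_one]
    refine pow_factorial_eq_one (hnormal _ h) (hcomm z) (hcomm g) ?_
    simp only [← map_mul, commutatorElement_def]
    congr 1
    group
  obtain ⟨k, hk, hx⟩ := exists_pow_mem_center (Nat.factorial_pos (Fintype.card n)) hpow x
  refine isOfFinOrder_iff_pow_eq_one.mpr ⟨k, hk, ?_⟩
  rw [← map_pow]
  exact (QuotientGroup.eq_one_iff _).mpr hx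

theorem exists_finset_conj_invariant {r : ℕ} (c : Fin r → Γ) [Finite (Γ ⧸ Subgroup.center Γ)] :
    ∃ T : Finset Γ, (∀ i, c i ∈ T) ∧ ∀ γ, ∀ t ∈ T, γ * t * γ⁻¹ ∈ T := by
  have hfin : (Set.range fun p : Γ × Fin r ↦ p.1 * c p.2 * p.1⁻¹).Finite := by
    refine (Set.finite_range fun p : (Γ ⧸ Subgroup.center Γ) × Fin r ↦
      p.1.out * c p.2 * p.1.out⁻¹).subset ?_
    rintro _ ⟨⟨x, i⟩, rfl⟩
    obtain ⟨⟨y, hy⟩, hxy⟩ := QuotientGroup.mk_out_eq_mul (Subgroup.center Γ) x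
    refine ⟨(x, i), ?_⟩
    have := Subgroup.mem_center_iff.mp hy (c i)
    simp only [hxy]
    rw [mul_assoc x, ← this]
    group
  refine ⟨hfin.toFinset, fun i ↦ by simpa using ⟨1, i, by simp⟩, fun γ t ht ↦ ?_⟩
  rw [Set.Finite.mem_toFinset] at ht ⊢
  obtain ⟨⟨x, i⟩, rfl⟩ := ht
  exact ⟨(γ * x, i), by group⟩

theorem exists_conj_isStarNormal {r : ℕ} {c : Fin r → Γ} [Group.IsNilpotent Γ]
    (hc : Subgroup.closure (Set.range c) = ⊤) {ρ : Γ →* (Matrix n n ℂ)ˣ}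
    (hρ : Function.Injective ρ)
    (hclosed : IsClosed {v : Fin r → Matrix n n ℂ | ∃ g : (Matrix n n ℂ)ˣ, ∀ i,
      v i = ((g * ρ (c i) * g⁻¹ : (Matrix n n ℂ)ˣ) : Matrix n n ℂ)}) :
    ∃ h : (Matrix n n ℂ)ˣ, ∀ γ,
      IsStarNormal ((h * ρ γ * h⁻¹ : (Matrix n n ℂ)ˣ) : Matrix n n ℂ) := by
  classical
  have hgen {T : Finset Γ} (hT : ∀ i, c i ∈ T) : Subgroup.closure (T : Set Γ) = ⊤ :=
    top_le_iff.mp (hc ▸ Subgroup.closure_mono (Set.range_subset_iff.mpr hT))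
  have hT₀ (i) : c i ∈ Finset.univ.image c := Finset.mem_image_of_mem c (Finset.mem_univ i)
  obtain ⟨h₀, hmin₀⟩ := exists_isMinimalOn_conj hc ρ hclosed hT₀
  have : Finite (Γ ⧸ Subgroup.center Γ) := by
    refine finite_quotient_center hc (ρ := (MulAut.conj h₀).toMonoidHom.comp ρ)
      ((MulAut.conj h₀).injective.comp hρ) fun γ hγ ↦ ?_
    have hγ' := Subgroup.mem_center_iff.mp hγ
    refine hmin₀.isStarNormal (hgen hT₀) (fun t ht ↦ ?_) fun t ht ↦ ?_
    · rwa [← hγ', mul_inv_cancel_right]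
    · rwa [mul_assoc, hγ', inv_mul_cancel_left]
  obtain ⟨T, hcT, hT⟩ := exists_finset_conj_invariant c
  obtain ⟨h, hmin⟩ := exists_isMinimalOn_conj hc ρ hclosed hcT
  exact ⟨h, fun γ ↦ hmin.isStarNormal (hgen hcT) (hT γ) fun t ht ↦ by simpa using hT γ⁻¹ t ht⟩

end

/-- The hard inclusion in the paper's Theorem III (via Richardson's polystability criterion
and Lemma 4.3): if the simultaneous-conjugation orbit of the tuple of generator images of a
representation `ρ` of a finitely generated nilpotent group `Γ` in `GL_n ℂ` is closed in
`M_n(ℂ)^r`, then `ρ` can be conjugated into the normal matrices. -/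
theorem polystable_conjugate_to_normal (Γ : Type) [Group Γ] [Group.IsNilpotent Γ]
    (r n : ℕ) (hn : 1 ≤ n) (c : Fin r → Γ) (hc : Subgroup.closure (Set.range c) = ⊤)
    (ρ : Γ →* (Matrix (Fin n) (Fin n) ℂ)ˣ)
    (hclosed : IsClosed {v : Fin r → Matrix (Fin n) (Fin n) ℂ |
      ∃ g : (Matrix (Fin n) (Fin n) ℂ)ˣ, ∀ i,
        v i = (g : Matrix (Fin n) (Fin n) ℂ) * (ρ (c i) : Matrix (Fin n) (Fin n) ℂ) *
          ((g⁻¹ : (Matrix (Fin n) (Fin n) ℂ)ˣ) : Matrix (Fin n) (Fin n) ℂ)}) :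
    ∃ h : (Matrix (Fin n) (Fin n) ℂ)ˣ, ∀ γ : Γ,
      ((h : Matrix (Fin n) (Fin n) ℂ) * (ρ γ : Matrix (Fin n) (Fin n) ℂ) *
          ((h⁻¹ : (Matrix (Fin n) (Fin n) ℂ)ˣ) : Matrix (Fin n) (Fin n) ℂ)) *
        ((h : Matrix (Fin n) (Fin n) ℂ) * (ρ γ : Matrix (Fin n) (Fin n) ℂ) *
          ((h⁻¹ : (Matrix (Fin n) (Fin n) ℂ)ˣ) : Matrix (Fin n) (Fin n) ℂ))ᴴ =
      ((h : Matrix (Fin n) (Fin n) ℂ) * (ρ γ : Matrix (Fin n) (Fin n) ℂ) *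
          ((h⁻¹ : (Matrix (Fin n) (Fin n) ℂ)ˣ) : Matrix (Fin n) (Fin n) ℂ))ᴴ *
        ((h : Matrix (Fin n) (Fin n) ℂ) * (ρ γ : Matrix (Fin n) (Fin n) ℂ) *
          ((h⁻¹ : (Matrix (Fin n) (Fin n) ℂ)ˣ) : Matrix (Fin n) (Fin n) ℂ)) := by
  have : Group.IsNilpotent ρ.range := Group.nilpotent_of_surjective _ ρ.rangeRestrict_surjective
  have hgen : Subgroup.closure (Set.range fun i ↦ ρ.rangeRestrict (c i)) = ⊤ := by
    rw [show (Set.range fun i ↦ ρ.rangeRestrict (c i)) = ρ.rangeRestrict '' Set.range c from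
      Set.range_comp _ _, ← MonoidHom.map_closure, hc]
    exact Subgroup.map_top_of_surjective _ ρ.rangeRestrict_surjective
  obtain ⟨h, hh⟩ := exists_conj_isStarNormal hgen (ρ := ρ.range.subtype) Subtype.val_injective
    hclosed
  exact ⟨h, fun γ ↦ (hh (ρ.rangeRestrict γ)).star_comm_self.eq.symm⟩
end

section
/- Let Γ be a nilpotent group generated by finitely many elements γ₁, …, γ_r, let n ≥ 1, and let ρ : Γ → GL_n(ℂ) be a group homomorphism such that ρ(γ) is a normal matrix for every γ ∈ Γ. Then the orbit {(g·ρ(γ₁)·g⁻¹, …, g·ρ(γ_r)·g⁻¹) : g ∈ GL_n(ℂ)} is a closed subset of the product space M_n(ℂ)^r (with its natural Euclidean topology). -/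
open Matrix
open Filter Topology

namespace Matrix

variable {n : Type*} [Fintype n] [DecidableEq n]

open scoped Matrix.Norms.L2Operator in
theorem star_mem_adjoin_of_isStarNormal {M : Matrix n n ℂ} (hM : IsStarNormal M) :
    star M ∈ Algebra.adjoin ℂ {M} := by
  let s := (finite_spectrum M).toFinset
  let q := Lagrange.interpolate s id (star : ℂ → ℂ)
  have h : Polynomial.aeval M q = star M := by
    rw [← cfc_polynomial q M hM, ← cfc_star_id (R := ℂ) M]
    refine cfc_congr fun z hz => ?_
    exact Lagrange.eval_interpolate_at_node (v := id) _ (Set.injOn_id _)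
      ((finite_spectrum M).mem_toFinset.2 hz)
  rw [← h]
  exact Polynomial.aeval_mem_adjoin_singleton ℂ M

open scoped ComplexOrder in
/-- A frame for a subspace of matrices, with respect to the Frobenius inner product. -/
theorem exists_frobenius_frame (S : Submodule ℂ (Matrix n n ℂ)) :
    ∃ (m : ℕ) (e : Fin m → Matrix n n ℂ), (∀ i, e i ∈ S) ∧
      ∀ a ∈ S, a = ∑ i, trace ((e i)ᴴ * a) • e i := by
  let : NormedAddCommGroup (Matrix n n ℂ) := toMatrixNormedAddCommGroup 1 PosDef.one
  let : InnerProductSpace ℂ (Matrix n n ℂ) := toMatrixInnerProductSpace 1 PosSemidef.one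
  let b := stdOrthonormalBasis ℂ S
  refine ⟨_, fun i => (b i : Matrix n n ℂ), fun i => (b i).2, fun a ha => ?_⟩
  have h := congrArg Subtype.val (b.sum_repr' ⟨a, ha⟩)
  rw [Submodule.coe_sum] at h
  refine h.symm.trans (Finset.sum_congr rfl fun i _ => ?_)
  rw [Submodule.coe_smul, Submodule.coe_inner]
  congr 1
  change trace (a * 1 * (b i : Matrix n n ℂ)ᴴ) = _
  rw [mul_one, trace_mul_comm]

open scoped ComplexOrder in
/-- A star-closed algebra of matrices has a Casimir tensor `∑ i, e i ⊗ (e i)ᴴ`, which commutes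
with the algebra (expressed by applying an arbitrary bilinear map) and whose product is
invertible. -/
theorem exists_casimir (A : Subalgebra ℂ (Matrix n n ℂ)) (hA : ∀ a ∈ A, aᴴ ∈ A) :
    ∃ (m : ℕ) (e : Fin m → Matrix n n ℂ), (∀ i, e i ∈ A) ∧
      (∀ a ∈ A, ∀ B : Matrix n n ℂ →ₗ[ℂ] Matrix n n ℂ →ₗ[ℂ] Matrix n n ℂ,
        ∑ i, B (a * e i) (e i)ᴴ = ∑ i, B (e i) ((e i)ᴴ * a)) ∧
      (∑ i, e i * (e i)ᴴ).det ≠ 0 := by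
  obtain ⟨m, e, heA, he⟩ := exists_frobenius_frame A.toSubmodule
  simp only [Subalgebra.mem_toSubmodule] at heA he
  have he' : ∀ a ∈ A, a = ∑ i, trace (a * e i) • (e i)ᴴ := fun a ha => by
    have h := congrArg conjTranspose (he aᴴ (hA a ha))
    rw [conjTranspose_conjTranspose, conjTranspose_sum] at h
    refine h.trans (Finset.sum_congr rfl fun i _ => ?_)
    rw [conjTranspose_smul, ← conjTranspose_mul, trace_conjTranspose, star_star]
  refine ⟨m, e, heA, fun a ha B => ?_, fun h0 => ?_⟩
  · have h1 : ∀ i, B (a * e i) (e i)ᴴ =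
        ∑ j, trace ((e j)ᴴ * a * e i) • B (e j) (e i)ᴴ := fun i => by
      conv_lhs => rw [he _ (A.mul_mem ha (heA i))]
      simp [mul_assoc]
    have h2 : ∀ j, B (e j) ((e j)ᴴ * a) =
        ∑ i, trace ((e j)ᴴ * a * e i) • B (e j) (e i)ᴴ := fun j => by
      conv_lhs => rw [he' _ (A.mul_mem (hA _ (heA j)) ha)]
      simp
    simp_rw [h1, h2]
    exact Finset.sum_comm
  · obtain ⟨x, hx, hzx⟩ := exists_mulVec_eq_zero_iff.2 h0
    have hsum : ∑ i, star ((e i)ᴴ *ᵥ x) ⬝ᵥ ((e i)ᴴ *ᵥ x) = 0 := by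
      have h := congrArg (fun y => star x ⬝ᵥ y) hzx
      simpa [sum_mulVec, dotProduct_sum, star_mulVec, dotProduct_mulVec, vecMul_vecMul] using h
    have hzero : ∀ i, (e i)ᴴ *ᵥ x = 0 := fun i =>
      dotProduct_star_self_eq_zero.1
        ((Finset.sum_eq_zero_iff_of_nonneg fun i _ => dotProduct_star_self_nonneg _).1
          hsum i (Finset.mem_univ i))
    refine hx ?_
    rw [← one_mulVec x, he' 1 A.one_mem, sum_mulVec]
    simp [smul_mulVec, hzero]

theorem conjTranspose_mem_adjoin {ι : Type*} {c : ι → Matrix n n ℂ}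
    (hc : ∀ i, IsStarNormal (c i)) :
    ∀ a ∈ Algebra.adjoin ℂ (Set.range c), aᴴ ∈ Algebra.adjoin ℂ (Set.range c) := by
  intro a ha
  induction ha using Algebra.adjoin_induction with
  | mem x hx =>
    obtain ⟨i, rfl⟩ := hx
    exact Algebra.adjoin_mono (Set.singleton_subset_iff.2 (Set.mem_range_self i))
      (star_mem_adjoin_of_isStarNormal (hc i))
  | algebraMap z =>
    rw [← star_eq_conjTranspose, ← algebraMap_star_comm]
    exact Subalgebra.algebraMap_mem _ _
  | add x y _ _ hx hy => rw [conjTranspose_add]; exact add_mem hx hy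
  | mul x y _ _ hx hy => rw [conjTranspose_mul]; exact mul_mem hy hx

theorem exists_tendsto_conj_of_mem_adjoin {ι : Type*} {c v : ι → Matrix n n ℂ}
    {l : Filter (Matrix n n ℂ)ˣ}
    (hv : ∀ i, Tendsto (fun g : (Matrix n n ℂ)ˣ => g.val * c i * g⁻¹.val) l (𝓝 (v i))) :
    ∀ a ∈ Algebra.adjoin ℂ (Set.range c),
      ∃ b, Tendsto (fun g : (Matrix n n ℂ)ˣ => g.val * a * g⁻¹.val) l (𝓝 b) := by
  intro a ha
  induction ha using Algebra.adjoin_induction with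
  | mem x hx =>
    obtain ⟨i, rfl⟩ := hx
    exact ⟨_, hv i⟩
  | algebraMap z =>
    refine ⟨algebraMap ℂ _ z, tendsto_const_nhds.congr fun g => ?_⟩
    rw [← Algebra.commutes, mul_assoc, g.mul_inv, mul_one]
  | add x y _ _ hx hy =>
    obtain ⟨b, hb⟩ := hx
    obtain ⟨d, hd⟩ := hy
    exact ⟨_, (hb.add hd).congr fun g => by rw [mul_add, add_mul]⟩
  | mul x y _ _ hx hy =>
    obtain ⟨b, hb⟩ := hx
    obtain ⟨d, hd⟩ := hy
    exact ⟨_, (hb.mul hd).congr fun g => by simp [mul_assoc]⟩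

/-- The simultaneous-conjugation orbit of a tuple of normal matrices is closed. -/
theorem isClosed_conj_orbit_of_isStarNormal {ι : Type*} {c : ι → Matrix n n ℂ}
    (hc : ∀ i, IsStarNormal (c i)) :
    IsClosed {v : ι → Matrix n n ℂ |
      ∃ g : (Matrix n n ℂ)ˣ, ∀ i, v i = g.val * c i * g⁻¹.val} := by
  refine isClosed_of_closure_subset fun v hv => ?_
  let F : (Matrix n n ℂ)ˣ → ι → Matrix n n ℂ := fun g i => g.val * c i * g⁻¹.val
  let l := comap F (𝓝 v)
  have hl : l.NeBot := by
    refine comap_neBot fun t ht => ?_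
    obtain ⟨w, hwt, g, hg⟩ := mem_closure_iff_nhds.1 hv t ht
    exact ⟨g, (funext hg : w = F g) ▸ hwt⟩
  have hF : ∀ i, Tendsto (fun g => F g i) l (𝓝 (v i)) :=
    fun i => tendsto_pi_nhds.1 tendsto_comap i
  obtain ⟨m, e, heA, hcomm, hdet⟩ := exists_casimir _ (conjTranspose_mem_adjoin hc)
  choose p hp using fun j => exists_tendsto_conj_of_mem_adjoin hF _ (heA j)
  choose q hq using fun j =>
    exists_tendsto_conj_of_mem_adjoin hF _ (conjTranspose_mem_adjoin hc _ (heA j))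
  let H : (Matrix n n ℂ)ˣ → Matrix n n ℂ := fun g => ∑ j, p j * (g.val * (e j)ᴴ * g⁻¹.val)
  have hH : Tendsto H l (𝓝 (∑ j, p j * q j)) :=
    tendsto_finsetSum _ fun j _ => (hq j).const_mul (p j)
  have hlim : (∑ j, p j * q j).det = (∑ j, e j * (e j)ᴴ).det := by
    have h1 := (continuous_id.matrix_det.tendsto _).comp
      (tendsto_finsetSum Finset.univ fun j _ => (hp j).mul (hq j))
    refine tendsto_nhds_unique h1 (tendsto_const_nhds.congr fun g => ?_)
    rw [← det_units_conj g]
    simp [Finset.mul_sum, Finset.sum_mul, mul_assoc]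
  have hunit : ∀ᶠ g in l, (H g).det ≠ 0 :=
    ((continuous_id.matrix_det.tendsto _).comp hH).eventually_ne (hlim ▸ hdet)
  have hinter : ∀ g i, v i * H g = H g * F g i := fun g i => by
    let E : (Matrix n n ℂ)ˣ → Matrix n n ℂ := fun k =>
      ∑ j, (k.val * e j * k⁻¹.val) * (g.val * (e j)ᴴ * g⁻¹.val)
    have hE : Tendsto E l (𝓝 (H g)) :=
      tendsto_finsetSum _ fun j _ => (hp j).mul_const _
    refine tendsto_nhds_unique ((hF i).mul hE) ((hE.mul_const _).congr fun k => ?_)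
    have h := hcomm (c i) (Algebra.subset_adjoin ⟨i, rfl⟩)
      ((LinearMap.mul ℂ (Matrix n n ℂ)).compl₁₂
        (LinearMap.mulLeftRight ℂ (k.val, k⁻¹.val)) (LinearMap.mulLeftRight ℂ (g.val, g⁻¹.val)))
    simp only [LinearMap.compl₁₂_apply, LinearMap.mul_apply', LinearMap.mulLeftRight_apply] at h
    simpa [E, F, Finset.mul_sum, Finset.sum_mul, mul_assoc] using h.symm
  obtain ⟨g, hg⟩ := hunit.exists
  let h := GeneralLinearGroup.mkOfDetNeZero (H g) hg
  refine ⟨h * g, fun i => ?_⟩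
  have h1 : v i * h.val = h.val * F g i := hinter g i
  rw [← Units.eq_mul_inv_iff_mul_eq] at h1
  simpa [F, mul_assoc] using h1

end Matrix

/-- Representations of a finitely generated nilpotent group by normal matrices are
polystable: if every `ρ(γ)` is normal, then the simultaneous-conjugation orbit of the
tuple of generator images is closed in `M_n(ℂ)^r` (by the paper's Theorem III such a
representation lies in the Kempf–Ness set, and by the Kempf–Ness Theorem its orbit
is closed). -/
theorem normal_rep_orbit_closed (Γ : Type) [Group Γ] [Group.IsNilpotent Γ]
    (r n : ℕ) (hn : 1 ≤ n) (c : Fin r → Γ) (hc : Subgroup.closure (Set.range c) = ⊤)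
    (ρ : Γ →* (Matrix (Fin n) (Fin n) ℂ)ˣ)
    (hnorm : ∀ γ : Γ, (ρ γ : Matrix (Fin n) (Fin n) ℂ) * (ρ γ : Matrix (Fin n) (Fin n) ℂ)ᴴ =
      (ρ γ : Matrix (Fin n) (Fin n) ℂ)ᴴ * (ρ γ : Matrix (Fin n) (Fin n) ℂ)) :
    IsClosed {v : Fin r → Matrix (Fin n) (Fin n) ℂ |
      ∃ g : (Matrix (Fin n) (Fin n) ℂ)ˣ, ∀ i,
        v i = (g : Matrix (Fin n) (Fin n) ℂ) * (ρ (c i) : Matrix (Fin n) (Fin n) ℂ) *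
          ((g⁻¹ : (Matrix (Fin n) (Fin n) ℂ)ˣ) : Matrix (Fin n) (Fin n) ℂ)} := by
  exact isClosed_conj_orbit_of_isStarNormal fun i => ⟨(hnorm (c i)).symm⟩
end

section
/- Let n, r ≥ 1 and let x₁, …, x_r be n×n real matrices. Then ∑_{i=1}^r ‖g·xᵢ·g⁻¹‖² ≥ ∑_{i=1}^r ‖xᵢ‖² holds for every g ∈ GL_n(ℝ) if and only if it holds for every g ∈ GL_n(ℂ) (regarding each xᵢ as a complex matrix); here ‖·‖ denotes the Frobenius norm. -/
open Matrix

/-- The squared Frobenius norm `‖m‖² = ∑ i j, |m i j|²` of a complex matrix. -/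
noncomputable def sqFrobNormC {n : ℕ} (m : Matrix (Fin n) (Fin n) ℂ) : ℝ :=
  ∑ i, ∑ j, ‖m i j‖ ^ 2

section KempfNess

variable {𝕜 n ι : Type*} [RCLike 𝕜] [Fintype n] [Fintype ι]

theorem trace_mul_conjTranspose_self_eq_sum_norm_sq (m : Matrix n n 𝕜) :
    (m * mᴴ).trace = ((∑ i, ∑ j, ‖m i j‖ ^ 2 : ℝ) : 𝕜) := by
  simp [trace, mul_apply, RCLike.mul_conj]

/-- The moment map of the simultaneous conjugation action on tuples of matrices. -/
def conjMoment (x : ι → Matrix n n 𝕜) : Matrix n n 𝕜 :=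
  ∑ k, (x k * (x k)ᴴ - (x k)ᴴ * x k)

theorem conjMoment_isHermitian (x : ι → Matrix n n 𝕜) : (conjMoment x).IsHermitian := by
  simp [conjMoment, IsHermitian, conjTranspose_sum]

theorem sum_norm_sq_mul_sub_eq_conjMoment (x : ι → Matrix n n 𝕜) (d : n → ℝ) :
    ∑ k, ∑ i, ∑ j, (d i - d j) * ‖x k i j‖ ^ 2 =
      ∑ i, d i * RCLike.re (conjMoment x i i) := by
  have h (i : n) : RCLike.re (conjMoment x i i) =
      ∑ k, (∑ j, ‖x k i j‖ ^ 2 - ∑ j, ‖x k j i‖ ^ 2) := by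
    have : conjMoment x i i =
        ((∑ k, (∑ j, ‖x k i j‖ ^ 2 - ∑ j, ‖x k j i‖ ^ 2) : ℝ) : 𝕜) := by
      simp [conjMoment, Matrix.sum_apply, mul_apply, RCLike.mul_conj, RCLike.conj_mul]
    rw [this, RCLike.ofReal_re]
  simp only [h, Finset.mul_sum, sub_mul, mul_sub, Finset.sum_sub_distrib]
  congr 1
  · exact Finset.sum_comm
  · rw [Finset.sum_comm]
    conv_lhs => rw [Finset.sum_comm]
    conv_rhs => rw [Finset.sum_comm]
    exact Finset.sum_congr rfl fun k _ => Finset.sum_comm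

variable [DecidableEq n]

theorem conjMoment_unitary_conj (x : ι → Matrix n n 𝕜) {u : Matrix n n 𝕜} (hu : u * uᴴ = 1) :
    conjMoment (fun k => uᴴ * x k * u) = uᴴ * conjMoment x * u := by
  have h (a b : Matrix n n 𝕜) : uᴴ * a * u * (uᴴ * b * u) = uᴴ * (a * b) * u := by
    calc _ = uᴴ * a * (u * uᴴ) * b * u := by simp only [Matrix.mul_assoc]
      _ = _ := by simp [hu, Matrix.mul_assoc]
  have h' (a : Matrix n n 𝕜) : (uᴴ * a * u)ᴴ = uᴴ * aᴴ * u := by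
    simp [Matrix.mul_assoc]
  simp only [conjMoment, h', h, Finset.mul_sum, Finset.sum_mul, mul_sub, sub_mul]

theorem sum_norm_sq_conj_eq (g : (Matrix n n 𝕜)ˣ) (x : Matrix n n 𝕜) {u : Matrix n n 𝕜}
    (hu : u * uᴴ = 1) {l : n → ℝ} (hl : ∀ i, l i ≠ 0)
    (hg : (g : Matrix n n 𝕜)ᴴ * g = u * diagonal (fun i => (l i : 𝕜)) * uᴴ) :
    ∑ i, ∑ j, ‖((g : Matrix n n 𝕜) * x * (g⁻¹ : (Matrix n n 𝕜)ˣ)) i j‖ ^ 2 =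
      ∑ i, ∑ j, l i * (l j)⁻¹ * ‖(uᴴ * x * u) i j‖ ^ 2 := by
  have hu' : uᴴ * u = 1 := mul_eq_one_comm.mp hu
  set L : Matrix n n 𝕜 := diagonal (fun i => (l i : 𝕜)) with hL
  set K : Matrix n n 𝕜 := diagonal (fun i => ((l i)⁻¹ : 𝕜)) with hK
  set a : Matrix n n 𝕜 := (g : Matrix n n 𝕜) with ha
  set b : Matrix n n 𝕜 := ((g⁻¹ : (Matrix n n 𝕜)ˣ) : Matrix n n 𝕜) with hb
  have hba : b * a = 1 := by simp [ha, hb]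
  have hab : a * b = 1 := by simp [ha, hb]
  have hLK : L * K = 1 := by
    simp [hL, hK, diagonal_mul_diagonal, hl]
  have hinv : b * bᴴ = u * K * uᴴ := by
    have h1 : (aᴴ * a) * (b * bᴴ) = 1 := by
      calc _ = aᴴ * (a * b) * bᴴ := by simp only [Matrix.mul_assoc]
        _ = 1 := by rw [hab, Matrix.mul_one, ← conjTranspose_mul, hba, conjTranspose_one]
    have h2 : (aᴴ * a) * (u * K * uᴴ) = 1 := by
      calc _ = u * L * (uᴴ * u) * K * uᴴ := by rw [hg]; simp only [Matrix.mul_assoc]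
        _ = u * (L * K) * uᴴ := by rw [hu', Matrix.mul_one]; simp only [Matrix.mul_assoc]
        _ = 1 := by rw [hLK, Matrix.mul_one, hu]
    exact (mul_eq_one_comm.mp h1 |> left_inv_eq_right_inv) h2
  set y := uᴴ * x * u with hy
  have key : (a * x * b * (a * x * b)ᴴ).trace = (L * y * K * yᴴ).trace := by
    calc _ = (a * (x * (b * bᴴ) * xᴴ * aᴴ)).trace := by
          simp only [conjTranspose_mul, Matrix.mul_assoc]
      _ = (x * (b * bᴴ) * xᴴ * (aᴴ * a)).trace := by
          rw [trace_mul_comm]; simp only [Matrix.mul_assoc]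
      _ = ((x * u * K * uᴴ * xᴴ * u * L) * uᴴ).trace := by
          rw [hg, hinv]; simp only [Matrix.mul_assoc]
      _ = ((y * K * yᴴ) * L).trace := by
          rw [trace_mul_comm, hy]
          simp only [conjTranspose_mul, conjTranspose_conjTranspose, Matrix.mul_assoc]
      _ = _ := by rw [trace_mul_comm]; simp only [Matrix.mul_assoc]
  rw [trace_mul_conjTranspose_self_eq_sum_norm_sq] at key
  have hr : (L * y * K * yᴴ).trace =
      ((∑ i, ∑ j, l i * (l j)⁻¹ * ‖y i j‖ ^ 2 : ℝ) : 𝕜) := by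
    push_cast
    rw [trace]
    refine Finset.sum_congr rfl fun i _ => ?_
    rw [diag_apply, mul_apply]
    refine Finset.sum_congr rfl fun j _ => ?_
    rw [hK, mul_diagonal, hL, diagonal_mul, conjTranspose_apply, ← RCLike.mul_conj,
      RCLike.star_def]
    ring
  rw [hr] at key
  exact_mod_cast key

open scoped ComplexOrder in
/-- A tuple of matrices has minimal Frobenius norm in its conjugation orbit if and only if its
moment vanishes. -/
theorem minimal_conj_orbit_iff_conjMoment_eq_zero (x : ι → Matrix n n 𝕜) :
    (∀ g : (Matrix n n 𝕜)ˣ, ∑ k, ∑ i, ∑ j, ‖x k i j‖ ^ 2 ≤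
      ∑ k, ∑ i, ∑ j, ‖((g : Matrix n n 𝕜) * x k * (g⁻¹ : (Matrix n n 𝕜)ˣ)) i j‖ ^ 2) ↔
      conjMoment x = 0 := by
  -- Unitary conjugation preserves the Frobenius norm.
  have hunit {u : Matrix n n 𝕜} (hu : u * uᴴ = 1) (m : Matrix n n 𝕜) :
      ∑ i, ∑ j, ‖m i j‖ ^ 2 = ∑ i, ∑ j, ‖(uᴴ * m * u) i j‖ ^ 2 := by
    simpa using sum_norm_sq_conj_eq 1 m hu (l := fun _ => 1) (by simp) (by simp [hu])
  constructor
  · intro hmin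
    have hH := conjMoment_isHermitian x
    set u : Matrix n n 𝕜 := (hH.eigenvectorUnitary : Matrix n n 𝕜)
    set d := hH.eigenvalues
    have hu : u * uᴴ = 1 := Unitary.coe_mul_star_self hH.eigenvectorUnitary
    have hu' : uᴴ * u = 1 := mul_eq_one_comm.mp hu
    have hspec : conjMoment x = u * diagonal (fun i => (d i : 𝕜)) * uᴴ := by
      have := hH.spectral_theorem
      rw [Unitary.conjStarAlgAut_apply] at this
      exact this
    have hconj : conjMoment (fun k => uᴴ * x k * u) = diagonal (fun i => (d i : 𝕜)) := by
      rw [conjMoment_unitary_conj x hu, hspec]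
      calc _ = (uᴴ * u) * diagonal (fun i => (d i : 𝕜)) * (uᴴ * u) := by
            simp only [Matrix.mul_assoc]
        _ = _ := by simp [hu']
    let f : ℝ → ℝ := fun t =>
      ∑ k, ∑ i, ∑ j, Real.exp (t * (d i - d j)) * ‖(uᴴ * x k * u) i j‖ ^ 2
    have hf (t : ℝ) : f 0 ≤ f t := by
      have hee (s : ℝ) : diagonal (fun i => (Real.exp (s * d i / 2) : 𝕜)) *
          diagonal (fun i => (Real.exp (-s * d i / 2) : 𝕜)) = 1 := by
        rw [diagonal_mul_diagonal, ← diagonal_one]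
        congr 1
        ext i
        rw [← RCLike.ofReal_mul, ← Real.exp_add]
        ring_nf
        simp
      let D : Matrix n n 𝕜 := diagonal (fun i => (Real.exp (t * d i / 2) : 𝕜))
      let E : Matrix n n 𝕜 := diagonal (fun i => (Real.exp (-t * d i / 2) : 𝕜))
      have hDE : D * E = 1 := hee t
      have h1 : D * uᴴ * (u * E) = 1 := by
        calc _ = D * (uᴴ * u) * E := by simp only [Matrix.mul_assoc]
          _ = 1 := by rw [hu', Matrix.mul_one, hDE]
      let g : (Matrix n n 𝕜)ˣ := ⟨D * uᴴ, u * E, h1, mul_eq_one_comm.mp h1⟩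
      have hDD : Dᴴ * D = diagonal (fun i => (Real.exp (t * d i) : 𝕜)) := by
        simp only [D, diagonal_conjTranspose, diagonal_mul_diagonal]
        congr 1
        ext i
        simp only [Pi.star_apply, RCLike.star_def, RCLike.conj_ofReal]
        rw [← RCLike.ofReal_mul, ← Real.exp_add]
        ring_nf
      have hg : (g : Matrix n n 𝕜)ᴴ * g =
          u * diagonal (fun i => (Real.exp (t * d i) : 𝕜)) * uᴴ := by
        rw [← hDD]
        simp [g, Matrix.mul_assoc]
      have := hmin g
      simp only [sum_norm_sq_conj_eq g _ hu (fun i => (Real.exp_pos (t * d i)).ne') hg] at this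
      simp only [hunit hu (x _)] at this
      simpa [f, mul_sub, Real.exp_sub, div_eq_mul_inv] using this
    have hderiv : HasDerivAt f
        (∑ k, ∑ i, ∑ j, (d i - d j) * ‖(uᴴ * x k * u) i j‖ ^ 2) 0 := by
      refine HasDerivAt.fun_sum fun k _ => HasDerivAt.fun_sum fun i _ =>
        HasDerivAt.fun_sum fun j _ => HasDerivAt.mul_const ?_ _
      simpa using ((hasDerivAt_id (0 : ℝ)).mul_const (d i - d j)).exp
    have hzero := IsLocalMin.hasDerivAt_eq_zero (Filter.Eventually.of_forall hf) hderiv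
    rw [sum_norm_sq_mul_sub_eq_conjMoment, hconj] at hzero
    simp only [diagonal_apply_eq, RCLike.ofReal_re] at hzero
    rw [Finset.sum_eq_zero_iff_of_nonneg fun i _ => mul_self_nonneg _] at hzero
    have hd0 (i : n) : d i = 0 := mul_self_eq_zero.mp (hzero i (Finset.mem_univ i))
    rw [hspec]
    simp [hd0]
  · intro h0 g
    have hP : ((g : Matrix n n 𝕜)ᴴ * g).PosDef :=
      Matrix.PosDef.conjTranspose_mul_self _ (mulVec_injective_of_isUnit g.isUnit)
    have hH := hP.isHermitian
    set u : Matrix n n 𝕜 := (hH.eigenvectorUnitary : Matrix n n 𝕜)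
    set l := hH.eigenvalues
    have hlpos (i : n) : 0 < l i := hP.eigenvalues_pos i
    have hu : u * uᴴ = 1 := Unitary.coe_mul_star_self hH.eigenvectorUnitary
    have hspec : (g : Matrix n n 𝕜)ᴴ * g = u * diagonal (fun i => (l i : 𝕜)) * uᴴ := by
      have := hH.spectral_theorem
      rw [Unitary.conjStarAlgAut_apply] at this
      exact this
    simp only [sum_norm_sq_conj_eq g _ hu (fun i => (hlpos i).ne') hspec, hunit hu (x _)]
    have hz := sum_norm_sq_mul_sub_eq_conjMoment (fun k => uᴴ * x k * u)
      (fun i => Real.log (l i))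
    rw [conjMoment_unitary_conj x hu, h0] at hz
    simp only [Matrix.zero_mul, Matrix.zero_apply, map_zero, mul_zero,
      Finset.sum_const_zero] at hz
    rw [← add_zero (∑ k, ∑ i, ∑ j, ‖(uᴴ * x k * u) i j‖ ^ 2), ← hz]
    simp only [← Finset.sum_add_distrib]
    refine Finset.sum_le_sum fun k _ => Finset.sum_le_sum fun i _ =>
      Finset.sum_le_sum fun j _ => ?_
    have hlog := Real.log_le_sub_one_of_pos (mul_pos (hlpos i) (inv_pos.mpr (hlpos j)))
    rw [Real.log_mul (hlpos i).ne' (inv_pos.mpr (hlpos j)).ne', Real.log_inv] at hlog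
    nlinarith [sq_nonneg ‖(uᴴ * x k * u) i j‖]

end KempfNess

theorem conjMoment_map_ofReal {n ι : Type*} [Fintype n] [Fintype ι]
    (x : ι → Matrix n n ℝ) :
    conjMoment (fun k => (x k).map Complex.ofReal) = (conjMoment x).map Complex.ofReal := by
  ext i j
  simp [conjMoment, Matrix.sum_apply, mul_apply]

/-- The instance for `G = GL_n` of Lemma 6.1 of the paper (`𝓜(ℝ) = 𝓜 ∩ V(ℝ)`): a tuple of
real matrices has minimal Frobenius norm within its `GL_n ℝ`-conjugation orbit if and only
if, regarded as complex matrices, it has minimal Frobenius norm within its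
`GL_n ℂ`-conjugation orbit. -/
theorem real_kempfNess_iff_complex (n r : ℕ) (hn : 1 ≤ n) (hr : 1 ≤ r)
    (x : Fin r → Matrix (Fin n) (Fin n) ℝ) :
    (∀ g : (Matrix (Fin n) (Fin n) ℝ)ˣ,
        ∑ i, sqFrobNormR ((g : Matrix (Fin n) (Fin n) ℝ) * x i *
            ((g⁻¹ : (Matrix (Fin n) (Fin n) ℝ)ˣ) : Matrix (Fin n) (Fin n) ℝ)) ≥
          ∑ i, sqFrobNormR (x i)) ↔
      (∀ g : (Matrix (Fin n) (Fin n) ℂ)ˣ,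
        ∑ i, sqFrobNormC ((g : Matrix (Fin n) (Fin n) ℂ) *
            (x i).map (Complex.ofReal) *
            ((g⁻¹ : (Matrix (Fin n) (Fin n) ℂ)ˣ) : Matrix (Fin n) (Fin n) ℂ)) ≥
          ∑ i, sqFrobNormC ((x i).map (Complex.ofReal))) := by
  refine (minimal_conj_orbit_iff_conjMoment_eq_zero x).trans (Iff.trans ?_
    (minimal_conj_orbit_iff_conjMoment_eq_zero fun k => (x k).map Complex.ofReal).symm)
  rw [conjMoment_map_ofReal, ← Matrix.map_zero Complex.ofReal Complex.ofReal_zero,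
    (Matrix.map_injective Complex.ofReal_injective).eq_iff]
end
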